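/- arXiv:1405.4496 — 14 statements merged into one kernel-verified Lean document; each statement's English description precedes it below -/
import Mathlib

section
/- (Kearns–Saul inequality.) For every p ∈ (0,1) with p ≠ 1/2 and every real t, one has p·exp(t(1−p)) + (1−p)·exp(−t·p) ≤ exp( ((1−2p)/(4·log((1−p)/p))) · t² ). -/
theorem ks_sinh (x y : ℝ) (hx : 0 ≤ x) (hxy : x ≤ y) : y * Real.sinh x ≤ x * Real.sinh y := by
  rcases hx.eq_or_lt with rfl | hx'
  · simp
  have hy : 0 < y := lt_of_lt_of_le hx' hxy
  have hc : ConvexOn ℝ (Set.Ici (0:ℝ)) Real.sinh := by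
    apply MonotoneOn.convexOn_of_deriv (convex_Ici 0) Real.continuous_sinh.continuousOn
      Real.differentiable_sinh.differentiableOn
    rw [Real.deriv_sinh, interior_Ici]
    intro a ha b hb hab
    rw [Real.cosh_le_cosh, abs_of_pos ha, abs_of_pos hb]
    exact hab
  have h := hc.2 (Set.mem_Ici.2 le_rfl) (Set.mem_Ici.2 hy.le)
    (show 0 ≤ 1 - x / y by rw [sub_nonneg]; exact (div_le_one hy).2 hxy)
    (show 0 ≤ x / y by positivity) (by ring)
  simp only [smul_eq_mul, mul_zero, zero_add, Real.sinh_zero, div_mul_cancel₀ _ hy.ne'] at h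
  calc y * Real.sinh x ≤ y * (x / y * Real.sinh y) := by gcongr
    _ = x * Real.sinh y := by field_simp

theorem ks_tanh (u v : ℝ) (hu : 0 ≤ u) (huv : u ≤ v) : u * Real.tanh v ≤ v * Real.tanh u := by
  have h := ks_sinh (v - u) (v + u) (by linarith) (by linarith)
  rw [Real.sinh_add, Real.sinh_sub] at h
  rw [Real.tanh_eq_sinh_div_cosh, Real.tanh_eq_sinh_div_cosh, ← mul_div_assoc, ← mul_div_assoc,
    div_le_div_iff₀ (Real.cosh_pos _) (Real.cosh_pos _)]
  nlinarith

theorem ks_aux (b u : ℝ) (hb : 0 < b) (hu : 0 ≤ u) :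
    Real.log (Real.cosh u) - Real.tanh b / (2 * b) * u ^ 2 ≤
      Real.log (Real.cosh b) - Real.tanh b / (2 * b) * b ^ 2 := by
  set F : ℝ → ℝ := fun u => Real.log (Real.cosh u) - Real.tanh b / (2 * b) * u ^ 2 with hF
  have hd : ∀ x, HasDerivAt F ((b * Real.tanh x - x * Real.tanh b) / b) x := by
    intro x
    have h1 := (Real.hasDerivAt_cosh x).log (Real.cosh_pos x).ne'
    have h2 := ((hasDerivAt_id x).pow 2).const_mul (Real.tanh b / (2 * b))
    refine (h1.sub h2).congr_deriv ?_
    rw [Real.tanh_eq_sinh_div_cosh x]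
    have := (Real.cosh_pos x).ne'
    simp
    field_simp
  have hcont : Continuous F := continuous_iff_continuousAt.2 fun x => (hd x).continuousAt
  change F u ≤ F b
  rcases le_total u b with h | h
  · have hm : MonotoneOn F (Set.Icc 0 b) := by
      apply monotoneOn_of_deriv_nonneg (convex_Icc 0 b) hcont.continuousOn
        (fun x _ => (hd x).differentiableAt.differentiableWithinAt)
      intro x hx
      rw [interior_Icc] at hx
      rw [(hd x).deriv]
      have := ks_tanh x b hx.1.le hx.2.le
      exact div_nonneg (by linarith) hb.le
    exact hm ⟨hu, h⟩ ⟨hb.le, le_rfl⟩ h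
  · have hm : AntitoneOn F (Set.Ici b) := by
      apply antitoneOn_of_deriv_nonpos (convex_Ici b) hcont.continuousOn
        (fun x _ => (hd x).differentiableAt.differentiableWithinAt)
      intro x hx
      rw [interior_Ici] at hx
      rw [(hd x).deriv]
      have := ks_tanh b x hb.le (le_of_lt hx)
      exact div_nonpos_of_nonpos_of_nonneg (by linarith) hb.le
    exact hm (Set.mem_Ici.2 le_rfl) h h

theorem ks_aux' (b u : ℝ) (hb : b ≠ 0) :
    Real.cosh u ≤ Real.cosh b * Real.exp (Real.tanh b / (2 * b) * (u ^ 2 - b ^ 2)) := by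
  have h := ks_aux |b| |u| (abs_pos.2 hb) (abs_nonneg u)
  have e : Real.tanh |b| / (2 * |b|) = Real.tanh b / (2 * b) := by
    rcases abs_choice b with h | h <;> rw [h]
    rw [Real.tanh_neg, mul_neg, neg_div_neg_eq]
  rw [e, Real.cosh_abs, Real.cosh_abs, sq_abs, sq_abs] at h
  rw [← Real.exp_log (Real.cosh_pos u)]
  nth_rewrite 1 [← Real.exp_log (Real.cosh_pos b)]
  rw [← Real.exp_add, Real.exp_le_exp]
  linarith

/-- **Kearns–Saul inequality.** For every `p ∈ (0,1)` with `p ≠ 1/2` and every real `t`,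
`p·exp(t(1−p)) + (1−p)·exp(−t·p) ≤ exp(((1−2p)/(4·log((1−p)/p)))·t²)`. -/
theorem kearns_saul (p t : ℝ) (hp0 : 0 < p) (hp1 : p < 1) (hp : p ≠ 1/2) :
    p * Real.exp (t * (1 - p)) + (1 - p) * Real.exp (-(t * p)) ≤
      Real.exp ((1 - 2*p) / (4 * Real.log ((1 - p) / p)) * t^2) := by
  have hq : 0 < 1 - p := by linarith
  obtain ⟨a, ha⟩ : ∃ a, Real.log ((1 - p) / p) = 2 * a := ⟨Real.log ((1 - p) / p) / 2, by ring⟩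
  have hE : Real.exp a * Real.exp a = (1 - p) / p := by
    rw [← Real.exp_add, ← two_mul, ← ha, Real.exp_log (by positivity)]
  have hE' : p * Real.exp a = (1 - p) * Real.exp (-a) := by
    rw [Real.exp_neg]
    have := Real.exp_pos a
    field_simp at hE ⊢
    linarith
  have ha0 : a ≠ 0 := by
    rintro rfl
    apply hp
    simp at hE'
    linarith
  have hc := Real.cosh_pos a
  have hce := Real.cosh_eq a
  have h1 : p * (2 * Real.cosh a) = Real.exp (-a) := by rw [hce]; linarith
  have h2 : (1 - p) * (2 * Real.cosh a) = Real.exp a := by rw [hce]; linarith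
  have ht : Real.tanh a = 1 - 2 * p := by
    rw [Real.tanh_eq_sinh_div_cosh, div_eq_iff hc.ne', Real.sinh_eq]
    linarith
  have key := ks_aux' a (t / 2 - a) ha0
  have hL : (p * Real.exp (t * (1 - p)) + (1 - p) * Real.exp (-(t * p))) * Real.cosh a =
      Real.exp (t / 2 * (1 - 2 * p)) * Real.cosh (t / 2 - a) := by
    have e1 : Real.exp (t / 2 * (1 - 2 * p)) * Real.exp (t / 2 - a) =
        Real.exp (-a) * Real.exp (t * (1 - p)) := by
      rw [← Real.exp_add, ← Real.exp_add]; ring_nf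
    have e2 : Real.exp (t / 2 * (1 - 2 * p)) * Real.exp (-(t / 2 - a)) =
        Real.exp a * Real.exp (-(t * p)) := by
      rw [← Real.exp_add, ← Real.exp_add]; ring_nf
    rw [← h1] at e1
    rw [← h2] at e2
    rw [Real.cosh_eq (t / 2 - a)]
    linear_combination (-1 / 2) * e1 + (-1 / 2) * e2
  refine le_of_mul_le_mul_right ?_ hc
  rw [hL, ha]
  calc _ ≤ Real.exp (t / 2 * (1 - 2 * p)) * (Real.cosh a *
        Real.exp (Real.tanh a / (2 * a) * ((t / 2 - a) ^ 2 - a ^ 2))) := by gcongr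
    _ = Real.exp (t / 2 * (1 - 2 * p) + Real.tanh a / (2 * a) * ((t / 2 - a) ^ 2 - a ^ 2))
        * Real.cosh a := by rw [Real.exp_add]; ring
    _ = _ := by
      rw [ht]
      congr 2
      field_simp
      ring
end

section
/- For every p ∈ (0,1), the function g_p is strictly monotonically increasing on the interval (−∞, t_p*] and strictly monotonically decreasing on the interval [t_p*, ∞); in particular g_p is strictly unimodal with unique maximum at t = t_p*. -/
/-- The function `g_p`: for `t ≠ 0`, `g_p(t) = log(M_p(t))/t²` where
`M_p(t) = p·exp(t(1−p)) + (1−p)·exp(−t·p)`, extended continuously by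
`g_p(0) = p(1−p)/2`. -/
noncomputable def gBer (p t : ℝ) : ℝ :=
  if t = 0 then p * (1 - p) / 2
  else Real.log (p * Real.exp (t * (1 - p)) + (1 - p) * Real.exp (-(t * p))) / t^2

namespace GB

noncomputable def D (p t : ℝ) : ℝ := p * Real.exp t + (1 - p)
noncomputable def q (p t : ℝ) : ℝ := p * Real.exp t / D p t
noncomputable def K (p t : ℝ) : ℝ := Real.log (D p t) - t * p
noncomputable def h (p t : ℝ) : ℝ := t * (q p t - p) - 2 * K p t
noncomputable def h1 (p t : ℝ) : ℝ := t * (q p t * (1 - q p t)) - (q p t - p)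
noncomputable def h2 (p t : ℝ) : ℝ := t * (q p t * (1 - q p t) * (1 - 2 * q p t))

variable {p : ℝ}

lemma D_pos (hp0 : 0 < p) (hp1 : p < 1) (t : ℝ) : 0 < D p t := by
  unfold D
  have := mul_pos hp0 (Real.exp_pos t)
  linarith

lemma q_pos (hp0 : 0 < p) (hp1 : p < 1) (t : ℝ) : 0 < q p t :=
  div_pos (mul_pos hp0 (Real.exp_pos t)) (D_pos hp0 hp1 t)

lemma q_lt (hp0 : 0 < p) (hp1 : p < 1) (t : ℝ) : q p t < 1 := by
  unfold q
  rw [div_lt_one (D_pos hp0 hp1 t)]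
  unfold D
  linarith

lemma hasD (t : ℝ) : HasDerivAt (D p) (p * Real.exp t) t :=
  ((Real.hasDerivAt_exp t).const_mul p).add_const (1 - p)

lemma hasq (hp0 : 0 < p) (hp1 : p < 1) (t : ℝ) :
    HasDerivAt (q p) (q p t * (1 - q p t)) t := by
  have hD := (D_pos hp0 hp1 t).ne'
  have := ((Real.hasDerivAt_exp t).const_mul p).div (hasD (p := p) t) hD
  refine this.congr_deriv ?_
  unfold q
  field_simp

lemma hasK (hp0 : 0 < p) (hp1 : p < 1) (t : ℝ) :
    HasDerivAt (K p) (q p t - p) t := by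
  have hD := (D_pos hp0 hp1 t).ne'
  have := ((hasD (p := p) t).log hD).sub ((hasDerivAt_id t).mul_const p)
  refine this.congr_deriv ?_
  simp [q]

lemma hash (hp0 : 0 < p) (hp1 : p < 1) (t : ℝ) : HasDerivAt (h p) (h1 p t) t := by
  have := ((hasDerivAt_id t).mul ((hasq hp0 hp1 t).sub_const p)).sub
    ((hasK hp0 hp1 t).const_mul 2)
  refine this.congr_deriv ?_
  simp [h1]; ring

lemma hash1 (hp0 : 0 < p) (hp1 : p < 1) (t : ℝ) : HasDerivAt (h1 p) (h2 p t) t := by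
  have hq := hasq hp0 hp1 t
  have := ((hasDerivAt_id t).mul (hq.mul (hq.const_sub 1))).sub (hq.sub_const p)
  refine this.congr_deriv ?_
  simp only [h2, Pi.mul_apply, id]; ring

lemma q0 : q p 0 = p := by simp [q, D]
lemma K0 : K p 0 = 0 := by simp [K, D]
lemma h0 : h p 0 = 0 := by simp [h, K0]
lemma h10 : h1 p 0 = 0 := by simp [h1, q0]

lemma q_lt_half (hp0 : 0 < p) (hp1 : p < 1) {t : ℝ} (ht : t < Real.log ((1 - p) / p)) :
    q p t < 1 / 2 := by
  have h1p : 0 < (1 - p) / p := div_pos (by linarith) hp0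
  rw [Real.lt_log_iff_exp_lt h1p, lt_div_iff₀ hp0] at ht
  unfold q
  rw [div_lt_iff₀ (D_pos hp0 hp1 t)]
  unfold D
  linarith

lemma half_lt_q (hp0 : 0 < p) (hp1 : p < 1) {t : ℝ} (ht : Real.log ((1 - p) / p) < t) :
    1 / 2 < q p t := by
  have h1p : 0 < (1 - p) / p := div_pos (by linarith) hp0
  rw [Real.log_lt_iff_lt_exp h1p, div_lt_iff₀ hp0] at ht
  unfold q
  rw [lt_div_iff₀ (D_pos hp0 hp1 t)]
  unfold D
  linarith

lemma h_two (hp0 : 0 < p) (hp1 : p < 1) : h p (2 * Real.log ((1 - p) / p)) = 0 := by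
  have h1p : 0 < (1 - p) / p := div_pos (by linarith) hp0
  have e : Real.exp (2 * Real.log ((1 - p) / p)) = ((1 - p) / p) ^ 2 := by
    rw [two_mul, Real.exp_add, Real.exp_log h1p, sq]
  have hD : D p (2 * Real.log ((1 - p) / p)) = (1 - p) / p := by
    unfold D; rw [e]; field_simp; ring
  have hq : q p (2 * Real.log ((1 - p) / p)) = 1 - p := by
    have : 1 - p ≠ 0 := by linarith
    unfold q; rw [hD, e]; field_simp
  unfold h K
  rw [hD, hq]; ring

lemma h2_neg_left (hp0 : 0 < p) (hp1 : p < 1) {t : ℝ} (ht : t < Real.log ((1 - p) / p))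
    (h0 : t < 0) : h2 p t < 0 := by
  have := q_lt_half hp0 hp1 ht
  exact mul_neg_of_neg_of_pos h0 (mul_pos (mul_pos (q_pos hp0 hp1 t)
    (by linarith)) (by linarith))

lemma h2_pos_mid (hp0 : 0 < p) (hp1 : p < 1) {t : ℝ} (ht : t < Real.log ((1 - p) / p))
    (h0 : 0 < t) : 0 < h2 p t := by
  have := q_lt_half hp0 hp1 ht
  exact mul_pos h0 (mul_pos (mul_pos (q_pos hp0 hp1 t)
    (by linarith)) (by linarith))

lemma h2_neg_right (hp0 : 0 < p) (hp1 : p < 1) {t : ℝ} (ht : Real.log ((1 - p) / p) < t)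
    (h0 : 0 < t) : h2 p t < 0 := by
  have := half_lt_q hp0 hp1 ht
  have h' := q_lt hp0 hp1 t
  exact mul_neg_of_pos_of_neg h0 (mul_neg_of_pos_of_neg (mul_pos (q_pos hp0 hp1 t)
    (by linarith)) (by linarith))

lemma conth (hp0 : 0 < p) (hp1 : p < 1) (s : Set ℝ) : ContinuousOn (h p) s :=
  fun x _ => (hash hp0 hp1 x).continuousAt.continuousWithinAt
lemma conth1 (hp0 : 0 < p) (hp1 : p < 1) (s : Set ℝ) : ContinuousOn (h1 p) s :=
  fun x _ => (hash1 hp0 hp1 x).continuousAt.continuousWithinAt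

lemma h_neg_left (hp0 : 0 < p) (hp1 : p < 1) (hs : 0 ≤ Real.log ((1 - p) / p)) {t : ℝ}
    (ht : t < 0) : h p t < 0 := by
  have a1 : StrictAntiOn (h1 p) (Set.Iic 0) := by
    apply strictAntiOn_of_deriv_neg (convex_Iic 0) (conth1 hp0 hp1 _)
    intro x hx
    rw [interior_Iic, Set.mem_Iio] at hx
    rw [(hash1 hp0 hp1 x).deriv]
    exact h2_neg_left hp0 hp1 (by linarith) hx
  have a2 : StrictMonoOn (h p) (Set.Iic 0) := by
    apply strictMonoOn_of_deriv_pos (convex_Iic 0) (conth hp0 hp1 _)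
    intro x hx
    rw [interior_Iic, Set.mem_Iio] at hx
    rw [(hash hp0 hp1 x).deriv, ← h10 (p := p)]
    exact a1 hx.le (Set.mem_Iic.2 le_rfl) hx
  rw [← h0 (p := p)]
  exact a2 ht.le (Set.mem_Iic.2 le_rfl) ht

lemma h_pos_mid (hp0 : 0 < p) (hp1 : p < 1) {t : ℝ} (ht : 0 < t)
    (hs : t ≤ Real.log ((1 - p) / p)) : 0 < h p t := by
  set s := Real.log ((1 - p) / p) with hsdef
  have a1 : StrictMonoOn (h1 p) (Set.Icc 0 s) := by
    apply strictMonoOn_of_deriv_pos (convex_Icc 0 s) (conth1 hp0 hp1 _)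
    intro x hx
    rw [interior_Icc] at hx
    rw [(hash1 hp0 hp1 x).deriv]
    exact h2_pos_mid hp0 hp1 hx.2 hx.1
  have a2 : StrictMonoOn (h p) (Set.Icc 0 s) := by
    apply strictMonoOn_of_deriv_pos (convex_Icc 0 s) (conth hp0 hp1 _)
    intro x hx
    rw [interior_Icc] at hx
    rw [(hash hp0 hp1 x).deriv, ← h10 (p := p)]
    exact a1 ⟨le_rfl, by linarith⟩ ⟨hx.1.le, hx.2.le⟩ hx.1
  rw [← h0 (p := p)]
  exact a2 ⟨le_rfl, by linarith⟩ ⟨ht.le, hs⟩ ht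

lemma h1_anti (hp0 : 0 < p) (hp1 : p < 1) (hs : 0 ≤ Real.log ((1 - p) / p)) :
    StrictAntiOn (h1 p) (Set.Ici (Real.log ((1 - p) / p))) := by
  apply strictAntiOn_of_deriv_neg (convex_Ici _) (conth1 hp0 hp1 _)
  intro x hx
  rw [interior_Ici, Set.mem_Ioi] at hx
  rw [(hash1 hp0 hp1 x).deriv]
  exact h2_neg_right hp0 hp1 hx (by linarith)

lemma h_conc (hp0 : 0 < p) (hp1 : p < 1) (hs : 0 ≤ Real.log ((1 - p) / p)) :
    StrictConcaveOn ℝ (Set.Ici (Real.log ((1 - p) / p))) (h p) := by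
  apply StrictAntiOn.strictConcaveOn_of_deriv (convex_Ici _) (conth hp0 hp1 _)
  have : deriv (h p) = h1 p := funext fun x => (hash hp0 hp1 x).deriv
  rw [this]
  exact (h1_anti hp0 hp1 hs).mono interior_subset

lemma h_pos (hp0 : 0 < p) (hp1 : p < 1) {t : ℝ} (ht : 0 < t)
    (hs : t < 2 * Real.log ((1 - p) / p)) : 0 < h p t := by
  rcases le_or_gt t (Real.log ((1 - p) / p)) with hc | hc
  · exact h_pos_mid hp0 hp1 ht hc
  have hs0 : 0 < Real.log ((1 - p) / p) := by linarith
  have := (h_conc hp0 hp1 hs0.le).lt_on_openSegment (Set.mem_Ici.2 le_rfl)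
    (Set.mem_Ici.2 (show _ ≤ 2 * Real.log ((1 - p) / p) by linarith)) (by linarith)
    (show t ∈ _ by rw [openSegment_eq_Ioo (by linarith)]; exact ⟨hc, hs⟩)
  rw [h_two hp0 hp1, min_eq_right (h_pos_mid hp0 hp1 hs0 le_rfl).le] at this
  exact this

lemma h_neg_right (hp0 : 0 < p) (hp1 : p < 1) (hs : 0 ≤ Real.log ((1 - p) / p)) {t : ℝ}
    (ht : 2 * Real.log ((1 - p) / p) < t) : h p t < 0 := by
  rcases hs.eq_or_lt with hs0 | hs0
  · have a1 := h1_anti hp0 hp1 hs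
    rw [← hs0] at a1 ht
    have a2 : StrictAntiOn (h p) (Set.Ici 0) := by
      apply strictAntiOn_of_deriv_neg (convex_Ici 0) (conth hp0 hp1 _)
      intro x hx
      rw [interior_Ici, Set.mem_Ioi] at hx
      rw [(hash hp0 hp1 x).deriv, ← h10 (p := p)]
      exact a1 (Set.mem_Ici.2 le_rfl) hx.le hx
    rw [← h0 (p := p)]
    exact a2 (Set.mem_Ici.2 le_rfl) (Set.mem_Ici.2 (by linarith)) (by linarith)
  · by_contra! hn
    have := (h_conc hp0 hp1 hs).lt_on_openSegment (Set.mem_Ici.2 le_rfl)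
      (Set.mem_Ici.2 (show _ ≤ t by linarith)) (by linarith)
      (show 2 * Real.log ((1 - p) / p) ∈ _ by
        rw [openSegment_eq_Ioo (by linarith)]; exact ⟨by linarith, ht⟩)
    rw [h_two hp0 hp1] at this
    exact absurd this (not_lt.2 (le_min (h_pos_mid hp0 hp1 hs0 le_rfl).le hn))

lemma g_eq (hp0 : 0 < p) (hp1 : p < 1) {t : ℝ} (ht : t ≠ 0) : gBer p t = K p t / t ^ 2 := by
  have e : p * Real.exp (t * (1 - p)) + (1 - p) * Real.exp (-(t * p))
      = D p t * Real.exp (-(t * p)) := by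
    have : t * (1 - p) = t + -(t * p) := by ring
    rw [this, Real.exp_add]; unfold D; ring
  unfold gBer K
  rw [if_neg ht, e, Real.log_mul (D_pos hp0 hp1 t).ne' (Real.exp_pos _).ne', Real.log_exp]
  rfl

lemma hasg (hp0 : 0 < p) (hp1 : p < 1) {t : ℝ} (ht : t ≠ 0) :
    HasDerivAt (gBer p) (h p t / t ^ 3) t := by
  have h1 : HasDerivAt (fun t => K p t / t ^ 2) (h p t / t ^ 3) t := by
    have := (hasK hp0 hp1 t).div (hasDerivAt_pow 2 t) (pow_ne_zero 2 ht)
    refine this.congr_deriv ?_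
    unfold h
    field_simp
    try ring
  refine h1.congr_of_eventuallyEq ?_
  filter_upwards [isOpen_ne.mem_nhds ht] with x hx
  exact g_eq hp0 hp1 hx

lemma g_cont0 (hp0 : 0 < p) (hp1 : p < 1) : ContinuousAt (gBer p) 0 := by
  rw [continuousAt_iff_punctured_nhds]
  have g0 : gBer p 0 = p * (1 - p) / 2 := by simp [gBer]
  rw [g0]
  have key : Filter.Tendsto (fun t => K p t / t ^ 2) (nhdsWithin 0 {0}ᶜ)
      (nhds (p * (1 - p) / 2)) := by
    apply HasDerivAt.lhopital_zero_nhdsNE (f' := fun t => q p t - p) (g' := fun t => 2 * t)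
    · exact Filter.Eventually.of_forall fun x => hasK hp0 hp1 x
    · exact Filter.Eventually.of_forall fun x => by simpa using hasDerivAt_pow 2 x
    · filter_upwards [self_mem_nhdsWithin] with x hx
      simpa using hx
    · have := (hasK hp0 hp1 0).continuousAt.tendsto
      rw [K0] at this
      exact this.mono_left nhdsWithin_le_nhds
    · have : Filter.Tendsto (fun t : ℝ => t ^ 2) (nhds 0) (nhds (0 ^ 2)) :=
        (continuous_pow 2).tendsto 0
      simp only [ne_eq, OfNat.ofNat_ne_zero, not_false_eq_true, zero_pow] at this
      exact this.mono_left nhdsWithin_le_nhds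
    · have := (hasDerivAt_iff_tendsto_slope.1 (hasq hp0 hp1 0)).div_const 2
      rw [q0] at this
      refine this.congr fun x => ?_
      rw [slope_def_field, q0, sub_zero, div_div, mul_comm]
  refine key.congr' ?_
  filter_upwards [self_mem_nhdsWithin] with x hx
  exact (g_eq hp0 hp1 hx).symm

lemma g_cont (hp0 : 0 < p) (hp1 : p < 1) (s : Set ℝ) : ContinuousOn (gBer p) s := by
  intro x _
  rcases eq_or_ne x 0 with rfl | hx
  · exact (g_cont0 hp0 hp1).continuousWithinAt
  · exact (hasg hp0 hp1 hx).continuousAt.continuousWithinAt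

lemma main (hp0 : 0 < p) (hp1 : p < 1) (hs : 0 ≤ Real.log ((1 - p) / p)) :
    StrictMonoOn (gBer p) (Set.Iic (2 * Real.log ((1 - p) / p))) ∧
    StrictAntiOn (gBer p) (Set.Ici (2 * Real.log ((1 - p) / p))) := by
  constructor
  · have a1 : StrictMonoOn (gBer p) (Set.Iic 0) := by
      apply strictMonoOn_of_deriv_pos (convex_Iic 0) (g_cont hp0 hp1 _)
      intro x hx
      rw [interior_Iic, Set.mem_Iio] at hx
      rw [(hasg hp0 hp1 hx.ne).deriv]
      exact div_pos_of_neg_of_neg (h_neg_left hp0 hp1 hs hx) (Odd.pow_neg (by decide) hx)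
    have a2 : StrictMonoOn (gBer p) (Set.Icc 0 (2 * Real.log ((1 - p) / p))) := by
      apply strictMonoOn_of_deriv_pos (convex_Icc _ _) (g_cont hp0 hp1 _)
      intro x hx
      rw [interior_Icc] at hx
      rw [(hasg hp0 hp1 hx.1.ne').deriv]
      exact div_pos (h_pos hp0 hp1 hx.1 hx.2) (pow_pos hx.1 3)
    have hle : 0 ≤ 2 * Real.log ((1 - p) / p) := by linarith
    have := a1.union a2 isGreatest_Iic (isLeast_Icc hle)
    rwa [Set.Iic_union_Icc_eq_Iic hle] at this
  · apply strictAntiOn_of_deriv_neg (convex_Ici _) (g_cont hp0 hp1 _)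
    intro x hx
    rw [interior_Ici, Set.mem_Ioi] at hx
    have hx0 : 0 < x := by linarith
    rw [(hasg hp0 hp1 hx0.ne').deriv]
    exact div_neg_of_neg_of_pos (h_neg_right hp0 hp1 hs hx) (pow_pos hx0 3)

lemma g_symm (t : ℝ) : gBer p t = gBer (1 - p) (-t) := by
  unfold gBer
  by_cases ht : t = 0
  · simp [ht]; ring
  · rw [if_neg ht, if_neg (neg_ne_zero.2 ht)]
    congr 1
    · congr 1
      rw [show -t * (1 - (1 - p)) = -(t * p) by ring, show -(-t * (1 - p)) = t * (1 - p) by ring]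
      ring
    · ring

end GB

/-- For every `p ∈ (0,1)`, the function `g_p` is strictly increasing on `(−∞, t_p*]`
and strictly decreasing on `[t_p*, ∞)`, where `t_p* = 2·log((1−p)/p)`; in particular
`g_p` is strictly unimodal with unique maximum at `t = t_p*`. -/
theorem gBer_strict_unimodal (p : ℝ) (hp0 : 0 < p) (hp1 : p < 1) :
    StrictMonoOn (gBer p) (Set.Iic (2 * Real.log ((1 - p) / p))) ∧
    StrictAntiOn (gBer p) (Set.Ici (2 * Real.log ((1 - p) / p))) := by
  rcases le_or_gt 0 (Real.log ((1 - p) / p)) with hs | hs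
  · exact GB.main hp0 hp1 hs
  · have e : Real.log ((1 - (1 - p)) / (1 - p)) = - Real.log ((1 - p) / p) := by
      rw [← Real.log_inv, inv_div, sub_sub_cancel]
    have := GB.main (p := 1 - p) (by linarith) (by linarith) (by rw [e]; linarith)
    rw [e] at this
    obtain ⟨m, a⟩ := this
    constructor
    · intro x hx y hy hxy
      rw [Set.mem_Iic] at hx hy
      rw [GB.g_symm x, GB.g_symm y]
      exact a (Set.mem_Ici.2 (by linarith)) (Set.mem_Ici.2 (by linarith)) (neg_lt_neg hxy)
    · intro x hx y hy hxy
      rw [Set.mem_Ici] at hx hy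
      rw [GB.g_symm x, GB.g_symm y]
      exact m (Set.mem_Iic.2 (by linarith)) (Set.mem_Iic.2 (by linarith)) (neg_lt_neg hxy)
end

section
/- For all p, q ∈ (0,1) with p + q ≠ 1, the derivative of g_{p,q} vanishes at t = t*_{p,q}, and g_{p,q}(t*_{p,q}) = (1 − p − q)/log(((1−p)(1−q))/(p·q)). -/
/-- `G_{p,q}(t) = exp(−t(p+q))·(1 + p(eᵗ−1))·(1 + q(eᵗ−1))`. -/
noncomputable def GPB (p q t : ℝ) : ℝ :=
  Real.exp (-(t * (p + q))) * (1 + p * (Real.exp t - 1)) * (1 + q * (Real.exp t - 1))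

/-- `g_{p,q}(t) = log(G_{p,q}(t))/t²` for `t ≠ 0`, extended continuously by
`g_{p,q}(0) = (p(1−p) + q(1−q))/2`. -/
noncomputable def gPB (p q t : ℝ) : ℝ :=
  if t = 0 then (p * (1 - p) + q * (1 - q)) / 2 else Real.log (GPB p q t) / t^2

/-- `t*_{p,q} = log(((1−p)(1−q))/(p·q))`. -/
noncomputable def tStar (p q : ℝ) : ℝ := Real.log ((1 - p) * (1 - q) / (p * q))

/-- For all `p, q ∈ (0,1)` with `p + q ≠ 1`, the derivative of `g_{p,q}` vanishes
at `t = t*_{p,q}` and `g_{p,q}(t*_{p,q}) = (1 − p − q)/log(((1−p)(1−q))/(p·q))`. -/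
theorem gPB_deriv_vanishes_at_tStar (p q : ℝ) (hp0 : 0 < p) (hp1 : p < 1)
    (hq0 : 0 < q) (hq1 : q < 1) (hpq : p + q ≠ 1) :
    deriv (gPB p q) (tStar p q) = 0 ∧
    gPB p q (tStar p q) = (1 - p - q) / Real.log ((1 - p) * (1 - q) / (p * q)) := by
  have hp1' : 0 < 1 - p := by linarith
  have hq1' : 0 < 1 - q := by linarith
  have hE : 0 < (1 - p) * (1 - q) / (p * q) := by positivity
  set T := tStar p q with hT
  have hexp : Real.exp T = (1 - p) * (1 - q) / (p * q) := by
    rw [hT, tStar, Real.exp_log hE]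
  have hT0 : T ≠ 0 := by
    intro h
    rw [h, Real.exp_zero, eq_div_iff (by positivity)] at hexp
    apply hpq
    linarith
  have hA : 1 + p * (Real.exp T - 1) = (1 - p) / q := by
    rw [hexp]; field_simp; ring
  have hB : 1 + q * (Real.exp T - 1) = (1 - q) / p := by
    rw [hexp]; field_simp; ring
  have hG : GPB p q T = Real.exp (T * (1 - p - q)) := by
    have h1 : T * (1 - p - q) = -(T * (p + q)) + T := by ring
    rw [GPB, hA, hB, h1, Real.exp_add, hexp]
    field_simp
  have hL : Real.log (GPB p q T) = T * (1 - p - q) := by rw [hG, Real.log_exp]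
  constructor
  · have hev : gPB p q =ᶠ[nhds T] fun t => Real.log (GPB p q t) / t ^ 2 := by
      filter_upwards [isOpen_ne.mem_nhds hT0] with t ht
      exact if_neg ht
    rw [hev.deriv_eq]
    have e1 : HasDerivAt (fun t : ℝ => Real.exp (-(t * (p + q))))
        (Real.exp (-(T * (p + q))) * (-(1 * (p + q)))) T :=
      (((hasDerivAt_id T).mul_const (p + q)).neg).exp
    have e2 : ∀ r : ℝ, HasDerivAt (fun t : ℝ => 1 + r * (Real.exp t - 1))
        (r * Real.exp T) T := fun r =>
      (((Real.hasDerivAt_exp T).sub_const 1).const_mul r).const_add 1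
    have hGd : HasDerivAt (GPB p q) (GPB p q T * (2 * (1 - p - q))) T := by
      have h := (e1.mul (e2 p)).mul (e2 q)
      refine HasDerivAt.congr_deriv (f := GPB p q) h ?_
      simp only [GPB, Pi.mul_apply]
      rw [hA, hB, hexp]
      field_simp
      ring
    have hGne : GPB p q T ≠ 0 := by rw [hG]; exact (Real.exp_pos _).ne'
    have hd := (hGd.log hGne).div (hasDerivAt_pow 2 T) (pow_ne_zero 2 hT0)
    refine (HasDerivAt.congr_deriv hd ?_).deriv
    rw [hL, mul_div_cancel_left₀ _ hGne]
    field_simp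
    push_cast
    ring
  · change _ = _ / T
    rw [gPB, if_neg hT0, hL]
    field_simp
end

section
/- Let (p,q) lie in the triangle Δ, i.e. 0 < q < min(p, 1−p). Then the derivative g_{p,q}′(t) is positive for all t < 0 if and only if 𝒜(p,q) ≥ 0, where 𝒜(p,q) = 2pq − p(2p−1) − q(2q−1). -/
lemma aux_neg (h0 h1 c : ℝ → ℝ) (l : ℝ)
    (H0 : ∀ t, HasDerivAt h0 (h1 t) t) (H1 : ∀ t, HasDerivAt h1 (t * c t) t)
    (z0 : h0 0 = 0) (z1 : h1 0 = 0) (hc : ∀ t, l < t → t < 0 → 0 < c t) :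
    ∀ t, l < t → t < 0 → h0 t < 0 := by
  have A1 : StrictAntiOn h1 (Set.Ioc l 0) := by
    apply strictAntiOn_of_deriv_neg (convex_Ioc l 0)
    · exact fun x _ => (H1 x).continuousAt.continuousWithinAt
    · intro x hx
      rw [interior_Ioc] at hx
      rw [(H1 x).deriv]
      exact mul_neg_of_neg_of_pos hx.2 (hc x hx.1 hx.2)
  have A0 : StrictMonoOn h0 (Set.Ioc l 0) := by
    apply strictMonoOn_of_deriv_pos (convex_Ioc l 0)
    · exact fun x _ => (H0 x).continuousAt.continuousWithinAt
    · intro x hx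
      rw [interior_Ioc] at hx
      rw [(H0 x).deriv, ← z1]
      exact A1 ⟨hx.1, hx.2.le⟩ ⟨hx.1.trans hx.2, le_rfl⟩ hx.2
  intro t h1 h2
  rw [← z0]
  exact A0 ⟨h1, h2.le⟩ ⟨h1.trans h2, le_rfl⟩ h2

noncomputable def auxD (p t : ℝ) : ℝ := 1 + p * (Real.exp t - 1)
noncomputable def auxP (p t : ℝ) : ℝ := p * Real.exp t / auxD p t

lemma auxD_pos {p : ℝ} (h0 : 0 < p) (h1 : p < 1) (t : ℝ) : 0 < auxD p t := by
  have := mul_pos h0 (Real.exp_pos t)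
  unfold auxD; nlinarith

lemma auxD_deriv (p t : ℝ) : HasDerivAt (auxD p) (p * Real.exp t) t := by
  unfold auxD
  exact (((Real.hasDerivAt_exp t).sub_const 1).const_mul p).const_add 1

lemma auxP_deriv {p : ℝ} (h0 : 0 < p) (h1 : p < 1) (t : ℝ) :
    HasDerivAt (auxP p) (auxP p t * (1 - auxP p t)) t := by
  have hD := (auxD_pos h0 h1 t).ne'
  have := ((Real.hasDerivAt_exp t).const_mul p).div (auxD_deriv p t) hD
  refine this.congr_deriv ?_
  unfold auxP
  field_simp

lemma auxPP_deriv {p : ℝ} (h0 : 0 < p) (h1 : p < 1) (t : ℝ) :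
    HasDerivAt (fun t => auxP p t * (1 - auxP p t))
      (auxP p t * (1 - auxP p t) * (1 - 2 * auxP p t)) t := by
  have h := auxP_deriv h0 h1 t
  refine (h.mul (h.const_sub 1)).congr_deriv ?_
  ring

noncomputable def auxF (p q t : ℝ) : ℝ :=
  -(t * (p + q)) + Real.log (auxD p t) + Real.log (auxD q t)
noncomputable def auxF1 (p q t : ℝ) : ℝ := -(p + q) + auxP p t + auxP q t
noncomputable def auxF2 (p q t : ℝ) : ℝ :=
  auxP p t * (1 - auxP p t) + auxP q t * (1 - auxP q t)
noncomputable def auxF3 (p q t : ℝ) : ℝ :=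
  auxP p t * (1 - auxP p t) * (1 - 2 * auxP p t) + auxP q t * (1 - auxP q t) * (1 - 2 * auxP q t)

section
variable {p q : ℝ} (p0 : 0 < p) (p1 : p < 1) (q0 : 0 < q) (q1 : q < 1)
include p0 p1 q0 q1

lemma auxF_deriv (t : ℝ) : HasDerivAt (auxF p q) (auxF1 p q t) t := by
  have a := (auxD_deriv p t).log (auxD_pos p0 p1 t).ne'
  have b := (auxD_deriv q t).log (auxD_pos q0 q1 t).ne'
  have c := ((hasDerivAt_id t).mul_const (p + q)).neg
  refine ((c.add a).add b).congr_deriv ?_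
  simp [auxF1, auxP]

lemma auxF1_deriv (t : ℝ) : HasDerivAt (auxF1 p q) (auxF2 p q t) t := 
  ((auxP_deriv p0 p1 t).const_add (-(p+q))).add (auxP_deriv q0 q1 t)

lemma auxF2_deriv (t : ℝ) : HasDerivAt (auxF2 p q) (auxF3 p q t) t := 
  (auxPP_deriv p0 p1 t).add (auxPP_deriv q0 q1 t)

lemma auxF3_eq (t : ℝ) : auxF3 p q t = Real.exp t * ((1-p)*(1-q) - p*q*Real.exp t^2) *
    ((1-p)*(1-q)*(p*(1-q)+q*(1-p)) + (6*p*q*(1-p)*(1-q) - p^2*(1-q)^2 - q^2*(1-p)^2) * Real.exp t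
      + p*q*(p*(1-q)+q*(1-p))*Real.exp t^2) / (auxD p t ^3 * auxD q t^3) := by
  have hp := (auxD_pos p0 p1 t).ne'
  have hq := (auxD_pos q0 q1 t).ne'
  unfold auxF3 auxP
  rw [eq_div_iff (by positivity)]
  field_simp
  unfold auxD
  ring

lemma auxg_deriv (t : ℝ) (ht : t < 0) :
    deriv (gPB p q) t = (t * auxF1 p q t - 2 * auxF p q t) / t ^ 3 := by
  have e : gPB p q =ᶠ[nhds t] fun t => auxF p q t / t ^ 2 := by
    filter_upwards [eventually_lt_nhds ht] with x hx
    have hp := (auxD_pos p0 p1 x).ne'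
    have hq := (auxD_pos q0 q1 x).ne'
    have : GPB p q x = Real.exp (-(x * (p + q))) * auxD p x * auxD q x := rfl
    rw [gPB, if_neg hx.ne, this, Real.log_mul (by positivity) hq,
      Real.log_mul (by positivity) hp, Real.log_exp, auxF]
  rw [e.deriv_eq]
  have := (auxF_deriv p0 p1 q0 q1 t).div (hasDerivAt_pow 2 t) (pow_ne_zero 2 ht.ne)
  have h := this.deriv
  have h2 := ht.ne
  refine h.trans ?_
  field_simp
  try push_cast
  try ring

lemma auxH1 (t : ℝ) : HasDerivAt (fun t => t * auxF1 p q t - 2 * auxF p q t)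
    (t * auxF2 p q t - auxF1 p q t) t := by
  refine (((hasDerivAt_id t).mul (auxF1_deriv p0 p1 q0 q1 t)).sub
    ((auxF_deriv p0 p1 q0 q1 t).const_mul 2)).congr_deriv ?_
  simp; ring

lemma auxH2 (t : ℝ) : HasDerivAt (fun t => t * auxF2 p q t - auxF1 p q t)
    (t * auxF3 p q t) t := by
  refine (((hasDerivAt_id t).mul (auxF2_deriv p0 p1 q0 q1 t)).sub
    (auxF1_deriv p0 p1 q0 q1 t)).congr_deriv ?_
  simp

lemma auxF3_cont : ContinuousAt (auxF3 p q) 0 := by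
  have a := (auxP_deriv p0 p1 0).continuousAt
  have b := (auxP_deriv q0 q1 0).continuousAt
  unfold auxF3
  fun_prop

end

/-- For `(p,q)` in the triangle `Δ` (`0 < q < min(p, 1−p)`), the derivative
`g_{p,q}′(t)` is positive for all `t < 0` if and only if
`𝒜(p,q) = 2pq − p(2p−1) − q(2q−1) ≥ 0`. -/
theorem gPB_deriv_pos_neg_axis_iff (p q : ℝ) (hq0 : 0 < q) (hq : q < min p (1 - p)) :
    (∀ t < 0, 0 < deriv (gPB p q) t) ↔
      0 ≤ 2*p*q - p*(2*p - 1) - q*(2*q - 1) := by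
  obtain ⟨hqp, hpq⟩ := lt_min_iff.1 hq
  have p0 : 0 < p := hq0.trans hqp
  have p1 : p < 1 := by linarith
  have q1 : q < 1 := by linarith
  have z0 : auxF p q 0 = 0 := by simp [auxF, auxD]
  have z1 : auxF1 p q 0 = 0 := by simp [auxF1, auxP, auxD]
  have pq := mul_pos p0 hq0
  constructor
  · intro h
    by_contra! hA
    have c0 : auxF3 p q 0 < 0 := by
      have : auxF3 p q 0 = (1 - p - q) * (2*p*q - p*(2*p - 1) - q*(2*q - 1)) := by
        simp [auxF3, auxP, auxD]; ring
      rw [this]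
      exact mul_neg_of_pos_of_neg (by linarith) hA
    obtain ⟨ε, hε, hb⟩ := Metric.eventually_nhds_iff.1
      ((auxF3_cont p0 p1 hq0 q1).eventually_lt_const c0)
    have key := aux_neg (fun t => -(t * auxF1 p q t - 2 * auxF p q t))
      (fun t => -(t * auxF2 p q t - auxF1 p q t)) (fun t => - auxF3 p q t) (-ε)
      (fun t => (auxH1 p0 p1 hq0 q1 t).neg)
      (fun t => (auxH2 p0 p1 hq0 q1 t).neg.congr_deriv (by ring))
      (by simp [z0]) (by simp [z1])
      (fun t h1 h2 => by
        have := hb (y := t) (by rw [Real.dist_eq, sub_zero, abs_lt]; constructor <;> linarith)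
        linarith) (-ε/2) (by linarith) (by linarith)
    have h3 := h (-ε/2) (by linarith)
    rw [auxg_deriv p0 p1 hq0 q1 _ (by linarith)] at h3
    have h4 : (-ε/2)^3 < 0 := Odd.pow_neg (by decide) (by linarith)
    have := div_neg_of_pos_of_neg (neg_lt_zero.1 key) h4
    linarith
  · intro hA t ht
    rw [auxg_deriv p0 p1 hq0 q1 _ ht]
    have h4 : t^3 < 0 := Odd.pow_neg (by decide) ht
    refine div_pos_of_neg_of_neg ?_ h4
    refine aux_neg (fun t => t * auxF1 p q t - 2 * auxF p q t) _ _ (t-1) (auxH1 p0 p1 hq0 q1)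
      (auxH2 p0 p1 hq0 q1) (by simp [z0]) (by simp [z1]) ?_ t (by linarith) ht
    intro x _ hx
    rw [auxF3_eq p0 p1 hq0 q1]
    have s0 := Real.exp_pos x
    have s1 : Real.exp x < 1 := Real.exp_lt_one_iff.2 hx
    have d1 := auxD_pos p0 p1 x
    have d2 := auxD_pos hq0 q1 x
    generalize Real.exp x = s at *
    have hm : 0 < p*(1-q)+q*(1-p) :=
      add_pos (mul_pos p0 (by linarith)) (mul_pos hq0 (by linarith))
    have k1 : p*q*s < p*q := by nlinarith
    have k2 : p*q*s^2 < p*q := by nlinarith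
    have k3 : 0 < (1-p)*(1-q) - p*q*s := by nlinarith
    have k4 : 0 < (1-p)*(1-q) - p*q*s^2 := by nlinarith
    have k5 := mul_pos (mul_pos hm (sub_pos.2 s1)) k3
    have k6 := mul_nonneg s0.le hA
    refine div_pos (mul_pos (mul_pos s0 k4) ?_) (by positivity)
    linear_combination k5 + k6
end

section
/- Let (p,q) lie in the triangle Δ, i.e. 0 < q < min(p, 1−p). Then 𝒜(p,q) ≥ 0 holds if and only if p < (3+√3)/6 and q ≥ max{0, (1 + 2p − √(1 + 12p(1−p)))/4}, where 𝒜(p,q) = 2pq − p(2p−1) − q(2q−1). -/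
/-- For `(p,q)` in the triangle `Δ` (`0 < q < min(p, 1−p)`), one has
`𝒜(p,q) = 2pq − p(2p−1) − q(2q−1) ≥ 0` if and only if `p < (3+√3)/6` and
`q ≥ α(p) = max{0, (1 + 2p − √(1 + 12p(1−p)))/4}`. -/
theorem A_nonneg_iff (p q : ℝ) (hq0 : 0 < q) (hq : q < min p (1 - p)) :
    0 ≤ 2*p*q - p*(2*p - 1) - q*(2*q - 1) ↔
      p < (3 + Real.sqrt 3) / 6 ∧
        max 0 ((1 + 2*p - Real.sqrt (1 + 12*p*(1 - p))) / 4) ≤ q := by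
  obtain ⟨h1, h2⟩ := lt_min_iff.mp hq
  have hD : 0 ≤ 1 + 12*p*(1 - p) := by
    have : 0 < p * (1 - p) := mul_pos (by linarith) (by linarith)
    nlinarith
  have h3 : Real.sqrt 3 ^ 2 = 3 := Real.sq_sqrt (by norm_num)
  have h30 : 0 < Real.sqrt 3 := Real.sqrt_pos.mpr (by norm_num)
  constructor
  · intro hA
    refine ⟨?_, max_le hq0.le ?_⟩
    · by_contra hp
      push Not at hp
      have h6 : Real.sqrt 3 ≤ 6*p - 3 := by linarith
      have h7 : 0 ≤ 6*p^2 - 6*p + 1 := by nlinarith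
      have h8 : 0 < (1 - p - q) * (4*p - 1 - 2*q) := mul_pos (by linarith) (by linarith)
      nlinarith
    · have : 1 + 2*p - 4*q ≤ Real.sqrt (1 + 12*p*(1 - p)) := by
        apply Real.le_sqrt_of_sq_le
        nlinarith
      linarith
  · rintro ⟨-, h⟩
    have h4 := (max_le_iff.mp h).2
    have h5 : 1 + 2*p - 4*q ≤ Real.sqrt (1 + 12*p*(1 - p)) := by linarith
    have h6 : (1 + 2*p - 4*q)^2 ≤ 1 + 12*p*(1 - p) := by
      rwa [Real.le_sqrt (by linarith) hD] at h5
    nlinarith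
end

section
/- For every p ∈ (0, (3+√3)/6) there exists a unique β ∈ (0, min(p, 1−p)) such that h_p(β) = 0; moreover h_p(q) > 0 for all q ∈ (0, β), h_p(q) < 0 for all q ∈ (β, min(p, 1−p)), and β > max{0, (1 + 2p − √(1 + 12p(1−p)))/4}. -/
/-- `h_p(q) = log(((1−p)(1−q))/(p·q)) − 2(1 − p − q)/(p(1−p) + q(1−q))`. -/
noncomputable def hPB (p q : ℝ) : ℝ :=
  Real.log ((1 - p) * (1 - q) / (p * q)) -
    2 * (1 - p - q) / (p * (1 - p) + q * (1 - q))

theorem hPB_hasDeriv (p q : ℝ) (hp0 : 0 < p) (hp1 : p < 1) (hq0 : 0 < q) (hq1 : q < 1) :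
    HasDerivAt (hPB p) ((1 - p - q)^2 * (-3*q^2 + 2*(1+p)*q - p^2) /
      (q * (1-q) * (p * (1 - p) + q * (1 - q))^2)) q := by
  have h1p : 0 < 1 - p := by linarith
  have h1q : 0 < 1 - q := by linarith
  have hD : 0 < p * (1 - p) + q * (1 - q) := by positivity
  have hi := hasDerivAt_id' q
  have e1 := ((hi.const_sub 1).const_mul (1-p)).div (hi.const_mul p) (by positivity)
  have e2 := e1.log (by simp only [Pi.div_apply]; positivity)
  have e3 := ((hi.const_sub (1-p)).const_mul 2).div
    ((hi.mul (hi.const_sub 1)).const_add (p * (1-p))) (by simpa using hD.ne')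
  have e4 := e2.sub e3
  refine HasDerivAt.congr_deriv (f := hPB p) e4 ?_
  simp only [Pi.div_apply, Pi.mul_apply]
  field_simp
  ring

theorem hPB_series_ineq (s : ℝ) (h0 : 0 < s) (h1 : s < 1/2) :
    6 * s / (1 - s^2) < Real.log ((1+s)/(1-s) * ((1+2*s)/(1-2*s))) := by
  let f : ℝ → ℝ := fun s => Real.log ((1+s)/(1-s) * ((1+2*s)/(1-2*s))) - 6 * s / (1 - s^2)
  have hd : ∀ x ∈ Set.Icc 0 s, HasDerivAt f (36 * x^4 / ((1-x^2)^2 * (1-4*x^2))) x := by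
    intro x hx
    obtain ⟨hx0, hx1⟩ := hx
    have a1 : 0 < 1 - x := by linarith
    have a2 : 0 < 1 - 2*x := by linarith
    have a3 : 0 < 1 - x^2 := by nlinarith
    have a4 : 0 < 1 - 4*x^2 := by nlinarith
    have hi := hasDerivAt_id' x
    have e1 := (hi.const_add 1).div (hi.const_sub 1) a1.ne'
    have e2 := ((hi.const_mul 2).const_add 1).div ((hi.const_mul 2).const_sub 1) a2.ne'
    have e3 := (e1.mul e2).log (by simp only [Pi.div_apply, Pi.mul_apply]; positivity)
    have e4 := (hi.const_mul 6).div ((hi.pow 2).const_sub 1) (by simpa using a3.ne')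
    refine HasDerivAt.congr_deriv (f := f) (e3.sub e4) ?_
    simp only [Pi.div_apply, Pi.mul_apply, Pi.pow_apply]
    have b3 : 1 - x^2 = (1-x)*(1+x) := by ring
    have b4 : 1 - 4*x^2 = (1-2*x)*(1+2*x) := by ring
    have a5 : 0 < 1 + x := by linarith
    have a6 : 0 < 1 + 2*x := by linarith
    rw [b3, b4]
    have n1 := a1.ne'
    have n2 := a2.ne'
    have n5 := a5.ne'
    have n6 := a6.ne'
    clear e1 e2 e3 e4 hi b3 b4
    obtain ⟨A, hA⟩ : ∃ A, A = 1 - x := ⟨_, rfl⟩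
    obtain ⟨B, hB⟩ : ∃ B, B = 1 + x := ⟨_, rfl⟩
    obtain ⟨C, hC⟩ : ∃ C, C = 1 - 2*x := ⟨_, rfl⟩
    obtain ⟨E, hE⟩ : ∃ E, E = 1 + 2*x := ⟨_, rfl⟩
    rw [← hA] at n1 ⊢
    rw [← hB] at n5 ⊢
    rw [← hC] at n2 ⊢
    rw [← hE] at n6 ⊢
    field_simp
    rw [hA, hB, hC, hE]
    push_cast
    ring
  have hm : StrictMonoOn f (Set.Icc 0 s) := by
    apply strictMonoOn_of_deriv_pos (convex_Icc 0 s)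
    · intro x hx
      exact (hd x hx).continuousAt.continuousWithinAt
    · intro x hx
      rw [interior_Icc] at hx
      rw [(hd x ⟨hx.1.le, hx.2.le⟩).deriv]
      obtain ⟨hx0, hx1⟩ := hx
      have a3 : 0 < 1 - x^2 := by nlinarith
      have a4 : 0 < 1 - 4*x^2 := by nlinarith
      positivity
  have := hm ⟨le_rfl, h0.le⟩ ⟨h0.le, le_rfl⟩ h0
  simp only [f] at this
  norm_num at this
  linarith

theorem hPB_curve_pos (p q : ℝ) (hp0 : 0 < p) (hq0 : 0 < q) (hs : p + q < 1)
    (hc : 2*q^2 - (1+2*p)*q + p*(2*p-1) = 0) : 0 < hPB p q := by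
  obtain ⟨s, hsd⟩ : ∃ s, s = 1 - p - q := ⟨_, rfl⟩
  have s0 : 0 < s := by linarith
  have s1 : s < 1 := by linarith
  have hm : 6 * (p * q) = (1-s)*(1-2*s) := by subst hsd; linarith
  have hpq : 0 < p * q := by positivity
  have s2 : s < 1/2 := by
    by_contra h
    nlinarith
  have key := hPB_series_ineq s s0 s2
  have hD : p * (1 - p) + q * (1 - q) = (1 - s^2)/3 := by
    have : p * (1 - p) + q * (1 - q) = s*(1-s) + 2*(p*q) := by subst hsd; ring
    rw [this]; linarith
  have a1 : 0 < 1 - s := by linarith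
  have a2 : 0 < 1 - 2*s := by linarith
  have a3 : 0 < 1 - s^2 := by nlinarith
  have hr : (1 - p) * (1 - q) / (p * q) = (1+s)/(1-s) * ((1+2*s)/(1-2*s)) := by
    have : (1 - p) * (1 - q) = s + p*q := by subst hsd; ring
    have h' : p * q = (1-s)*(1-2*s)/6 := by linarith
    rw [this, h']
    field_simp
    ring
  unfold hPB
  rw [hr, hD, ← hsd]
  have : 2 * s / ((1 - s^2)/3) = 6 * s / (1 - s^2) := by
    field_simp
    norm_num
  rw [this]; linarith

theorem hPB_end (p : ℝ) (hp0 : 0 < p) (hp1 : p < 1) : hPB p (min p (1 - p)) ≤ 0 := by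
  have h1p : 0 < 1 - p := by linarith
  rcases le_total p (1-p) with h | h
  · rw [min_eq_left h]
    have ht : 1 ≤ (1-p)/p := by rw [le_div_iff₀ hp0]; linarith
    have h1 := Real.self_le_sinh_iff.2 (Real.log_nonneg ht)
    rw [Real.sinh_log (by positivity)] at h1
    unfold hPB
    have h2 : (1 - p) * (1 - p) / (p * p) = ((1-p)/p)^2 := by field_simp
    rw [h2, Real.log_pow]
    have h3 : 2 * (1 - p - p) / (p * (1 - p) + p * (1 - p)) = (1-p)/p - ((1-p)/p)⁻¹ := by
      field_simp
      ring
    rw [h3]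
    push_cast
    linarith
  · rw [min_eq_right h]
    unfold hPB
    have h2 : (1 - p) * (1 - (1 - p)) / (p * (1-p)) = 1 := by
      field_simp
      ring
    rw [h2]
    simp

theorem hPB_small (p c : ℝ) (hp0 : 0 < p) (hp1 : p < 1) (hc0 : 0 < c) (hc : c < 1 - p) :
    ∃ q, 0 < q ∧ q < c ∧ 0 < hPB p q := by
  have h1p : 0 < 1 - p := by linarith
  obtain ⟨K, hK⟩ : ∃ K, K = p/(1-p) * Real.exp (2/p) + 1/c := ⟨_, rfl⟩
  have hE := Real.exp_pos (2/p)
  have hK0 : 0 < K := by rw [hK]; positivity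
  have hKc : 1 / c < 1 + K := by
    have : 0 < p/(1-p) * Real.exp (2/p) := by positivity
    linarith
  have hqc : 1 / (1+K) < c := by
    rw [div_lt_iff₀ (by positivity)]
    rw [div_lt_iff₀ hc0] at hKc
    linarith
  obtain ⟨q, hq⟩ : ∃ q, q = 1/(1+K) := ⟨_, rfl⟩
  rw [← hq] at hqc
  have hq0 : 0 < q := by rw [hq]; positivity
  refine ⟨q, hq0, hqc, ?_⟩
  have h1q : 0 < 1 - q := by linarith
  have hr : (1 - p) * (1 - q) / (p * q) = (1-p)/p * K := by
    rw [hq]; field_simp; ring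
  have h1 : Real.exp (2/p) < (1 - p) * (1 - q) / (p * q) := by
    rw [hr, hK]
    have : (1-p)/p * (p/(1-p) * Real.exp (2/p) + 1/c) = Real.exp (2/p) + (1-p)/p * (1/c) := by
      field_simp
    rw [this]
    have : 0 < (1-p)/p * (1/c) := by positivity
    linarith
  have h2 := (Real.lt_log_iff_exp_lt (by positivity)).2 h1
  have h3 : 2 * (1 - p - q) / (p * (1 - p) + q * (1 - q)) ≤ 2/p := by
    rw [div_le_div_iff₀ (by positivity) hp0]
    nlinarith [mul_pos hq0 h1q, mul_pos hq0 hp0]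
  unfold hPB
  linarith

set_option maxHeartbeats 1000000 in
theorem hPB_unique_root (p : ℝ) (hp0 : 0 < p) (hp1 : p < (3 + Real.sqrt 3) / 6) :
    ∃ β ∈ Set.Ioo 0 (min p (1 - p)),
      hPB p β = 0 ∧
      (∀ q ∈ Set.Ioo (0:ℝ) β, 0 < hPB p q) ∧
      (∀ q ∈ Set.Ioo β (min p (1 - p)), hPB p q < 0) ∧
      max 0 ((1 + 2*p - Real.sqrt (1 + 12*p*(1 - p))) / 4) < β ∧
      (∀ β' ∈ Set.Ioo 0 (min p (1 - p)), hPB p β' = 0 → β' = β) := by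
  have h3 : Real.sqrt 3 ^ 2 = 3 := Real.sq_sqrt (by norm_num)
  have h30 : 0 ≤ Real.sqrt 3 := Real.sqrt_nonneg 3
  have hp : p < 1 := by nlinarith
  have h1p : 0 < 1 - p := by linarith
  -- the discriminant sign
  have hdisc : 1/2 ≤ p → 0 < -1 + 6*p - 6*p^2 := by
    intro h
    nlinarith
  obtain ⟨m, hm⟩ : ∃ m, m = min p (1-p) := ⟨_, rfl⟩
  have hmp : m ≤ p := hm ▸ min_le_left _ _
  have hm1 : m ≤ 1 - p := hm ▸ min_le_right _ _
  have hm0 : 0 < m := hm ▸ lt_min hp0 h1p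
  have hend : hPB p m ≤ 0 := hm ▸ hPB_end p hp0 hp
  rw [← hm]
  have hQm : 0 < -3*m^2 + 2*(1+p)*m - p^2 := by
    rcases le_total p (1-p) with h | h
    · rw [hm, min_eq_left h]; nlinarith [mul_pos hp0 h1p]
    · rw [hm, min_eq_right h]; nlinarith [hdisc (by linarith)]
  -- roots of the quadratic
  obtain ⟨w, hw⟩ : ∃ w, w = Real.sqrt (1 + 2*p - 2*p^2) := ⟨_, rfl⟩
  have hw0 : 0 ≤ w := hw ▸ Real.sqrt_nonneg _
  have hw2 : w^2 = 1 + 2*p - 2*p^2 := by rw [hw]; exact Real.sq_sqrt (by nlinarith)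
  obtain ⟨c, hc⟩ : ∃ c, c = (1 + p - w)/3 := ⟨_, rfl⟩
  obtain ⟨d, hd⟩ : ∃ d, d = (1 + p + w)/3 := ⟨_, rfl⟩
  have hQ : ∀ q : ℝ, -3*q^2 + 2*(1+p)*q - p^2 = 3*((q - c)*(d - q)) := by
    intro q
    rw [hc, hd]
    linear_combination (-1/3) * hw2
  have hcd : c ≤ d := by rw [hc, hd]; linarith
  have hc0 : 0 < c := by
    have : w < 1 + p := by nlinarith
    rw [hc]; linarith
  have hcm : c < m := by
    by_contra h
    rw [hQ] at hQm
    nlinarith [mul_nonneg (sub_nonneg.2 (not_lt.1 h)) (sub_nonneg.2 ((not_lt.1 h).trans hcd))]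
  have hmd : m < d := by
    by_contra h
    rw [hQ] at hQm
    nlinarith [mul_nonneg (sub_nonneg.2 hcm.le) (sub_nonneg.2 (not_lt.1 h))]
  have hder : ∀ q, 0 < q → q ≤ m → HasDerivAt (hPB p) ((1 - p - q)^2 * (3*((q - c)*(d - q))) /
      (q * (1-q) * (p * (1 - p) + q * (1 - q))^2)) q := by
    intro q h0 h1
    have := hPB_hasDeriv p q hp0 hp h0 (by linarith)
    rwa [hQ] at this
  have hcont : ContinuousOn (hPB p) (Set.Ioc 0 m) := fun q hq =>
    (hder q hq.1 hq.2).continuousAt.continuousWithinAt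
  have hanti : StrictAntiOn (hPB p) (Set.Ioc 0 c) := by
    apply strictAntiOn_of_deriv_neg (convex_Ioc 0 c)
    · exact hcont.mono (Set.Ioc_subset_Ioc_right hcm.le)
    · intro x hx
      rw [interior_Ioc] at hx
      obtain ⟨x0, x1⟩ := hx
      rw [(hder x x0 (by linarith)).deriv]
      have a1 : 0 < 1 - x := by linarith
      have a2 : 0 < 1 - p - x := by linarith
      apply div_neg_of_neg_of_pos
      · apply mul_neg_of_pos_of_neg (by positivity)
        have := mul_pos (sub_pos.2 x1) (sub_pos.2 (show x < d by linarith))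
        linarith
      · positivity
  have hmono : StrictMonoOn (hPB p) (Set.Icc c m) := by
    apply strictMonoOn_of_deriv_pos (convex_Icc c m)
    · exact hcont.mono (fun x hx => ⟨by linarith [hx.1], hx.2⟩)
    · intro x hx
      rw [interior_Icc] at hx
      obtain ⟨x0, x1⟩ := hx
      have xx : 0 < x := by linarith
      rw [(hder x xx x1.le).deriv]
      have a1 : 0 < 1 - x := by linarith
      have a2 : 0 < 1 - p - x := by linarith
      have := mul_pos (sub_pos.2 x0) (sub_pos.2 (show x < d by linarith))
      positivity
  have hneg : ∀ q, c ≤ q → q < m → hPB p q < 0 := fun q h1 h2 =>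
    (hmono ⟨h1, h2.le⟩ ⟨hcm.le, le_rfl⟩ h2).trans_le hend
  obtain ⟨q₁, hq10, hq1c, hq1⟩ := hPB_small p c hp0 hp hc0 (by linarith)
  obtain ⟨β, ⟨hβ1, hβ2⟩, hβ⟩ : (0:ℝ) ∈ hPB p '' Set.Icc q₁ c := by
    apply intermediate_value_Icc' hq1c.le
    · exact hcont.mono (fun x hx => ⟨by linarith [hx.1], by linarith [hx.2]⟩)
    · exact ⟨(hneg c le_rfl hcm).le, hq1.le⟩
  have hβ0 : 0 < β := by linarith
  have hpos : ∀ q ∈ Set.Ioo (0:ℝ) β, 0 < hPB p q := by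
    intro q hq
    rw [← hβ]
    exact hanti ⟨hq.1, by linarith [hq.2]⟩ ⟨hβ0, hβ2⟩ hq.2
  have hneg' : ∀ q ∈ Set.Ioo β m, hPB p q < 0 := by
    intro q hq
    rcases le_total q c with h | h
    · rw [← hβ]
      exact hanti ⟨hβ0, hβ2⟩ ⟨by linarith [hq.1], h⟩ hq.1
    · exact hneg q h hq.2
  refine ⟨β, ⟨hβ0, by linarith⟩, hβ, hpos, hneg', ?_, ?_⟩
  · apply max_lt hβ0
    obtain ⟨v, hv⟩ : ∃ v, v = Real.sqrt (1 + 12*p*(1-p)) := ⟨_, rfl⟩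
    have hv0 : 0 ≤ v := hv ▸ Real.sqrt_nonneg _
    have hv2 : v^2 = 1 + 12*p*(1-p) := by
      rw [hv]; exact Real.sq_sqrt (by nlinarith [mul_pos hp0 h1p])
    rw [← hv]
    obtain ⟨a, ha⟩ : ∃ a, a = (1 + 2*p - v)/4 := ⟨_, rfl⟩
    rw [← ha]
    rcases le_or_gt a 0 with h | h
    · linarith
    have hp2 : 1/2 ≤ p := by
      have h1 : v < 1 + 2*p := by linarith
      have h2 : v^2 < (1 + 2*p)^2 := pow_lt_pow_left₀ h1 hv0 (by norm_num)
      rw [hv2] at h2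
      have h4 : 0 < p * (2*p - 1) := by linarith
      have h5 := (mul_pos_iff_of_pos_left hp0).1 h4
      linarith
    have hd' := hdisc hp2
    have hcurve : 2*a^2 - (1+2*p)*a + p*(2*p-1) = 0 := by
      rw [ha]; linear_combination (1/8) * hv2
    have ha1 : p + a < 1 := by
      have : 6*p - 3 < v := by
        apply lt_of_pow_lt_pow_left₀ 2 hv0
        rw [hv2]
        linarith
      linarith
    have hma : a < m := by rw [hm]; exact lt_min (by linarith) (by linarith)
    have hpa := hPB_curve_pos p a hp0 h ha1 hcurve
    rcases lt_trichotomy a β with h' | h' | h'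
    · exact h'
    · rw [h', hβ] at hpa; exact absurd hpa (lt_irrefl _)
    · exact absurd (hneg' a ⟨h', hma⟩) (by linarith)
  · intro b hb hb0
    rcases lt_trichotomy b β with h' | h' | h'
    · exact absurd (hpos b ⟨hb.1, h'⟩) (by linarith)
    · exact h'
    · exact absurd (hneg' b ⟨h', hb.2⟩) (by linarith)
end

section
/- For every p ∈ ((3+√3)/6, 1), one has h_p(q) > 0 for all q ∈ (0, 1−p); in particular h_p has no root in (0, 1−p). -/
/-- For every `p ∈ ((3+√3)/6, 1)`, one has `h_p(q) > 0` for all `q ∈ (0, 1−p)`;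
in particular `h_p` has no root in `(0, 1−p)`. -/
theorem hPB_pos_of_p_large (p : ℝ) (hp0 : (3 + Real.sqrt 3) / 6 < p) (hp1 : p < 1) :
    (∀ q ∈ Set.Ioo 0 (1 - p), 0 < hPB p q) ∧
    ¬∃ q ∈ Set.Ioo 0 (1 - p), hPB p q = 0 := by
  have h3 : Real.sqrt 3 ^ 2 = 3 := Real.sq_sqrt (by norm_num)
  have h30 : 0 ≤ Real.sqrt 3 := Real.sqrt_nonneg 3
  have hp2 : 1 / 2 < p := by linarith
  have hkey : 0 < 1 - 6 * p + 6 * p ^ 2 := by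
    nlinarith [mul_pos (sub_pos.2 hp0) (sub_pos.2 hp0), mul_nonneg h30 (sub_pos.2 hp0).le]
  have main : ∀ q ∈ Set.Ioo 0 (1 - p), 0 < hPB p q := by
    rintro q ⟨hq0, hq1⟩
    let f : ℝ → ℝ := fun x => Real.log (1 - x) - Real.log x -
      2 * (1 - p - x) / (p * (1 - p) + x * (1 - x))
    have hS : ∀ x, 0 < x → x ≤ 1 - p → 0 < p * (1 - p) + x * (1 - x) := by
      intro x hx hx1
      have h1 : 0 < p * (1 - p) := mul_pos (by linarith) (by linarith)
      have h2 : 0 < x * (1 - x) := mul_pos hx (by linarith)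
      linarith
    have hd : ∀ x, 0 < x → x ≤ 1 - p → HasDerivAt f
        ((-1) / (1 - x) - 1 / x - ((2 * (-1)) * (p * (1 - p) + x * (1 - x)) -
          2 * (1 - p - x) * (1 * (1 - x) + x * (-1))) / (p * (1 - p) + x * (1 - x)) ^ 2) x := by
      intro x hx hx1
      have hi := hasDerivAt_id' x
      have h1 : HasDerivAt (fun y : ℝ => 1 - y) (-1) x := hi.const_sub 1
      have h2 : HasDerivAt (fun y : ℝ => 2 * (1 - p - y)) (2 * (-1)) x :=
        (hi.const_sub (1 - p)).const_mul 2
      have h4 : HasDerivAt (fun y : ℝ => p * (1 - p) + y * (1 - y))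
          (1 * (1 - x) + x * (-1)) x := (hi.mul h1).const_add _
      exact ((h1.log (by linarith)).sub (hi.log hx.ne')).sub (h2.div h4 (hS x hx hx1).ne')
    have hanti : StrictAntiOn f (Set.Icc q (1 - p)) := by
      apply strictAntiOn_of_deriv_neg (convex_Icc _ _)
      · intro x hx
        exact (hd x (by linarith [hx.1]) hx.2).continuousAt.continuousWithinAt
      · intro x hx
        rw [interior_Icc] at hx
        obtain ⟨hx0, hx1⟩ := hx
        have hxp : 0 < x := by linarith
        have hSx := hS x hxp hx1.le
        rw [(hd x hxp hx1.le).deriv]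
        have h1x : 0 < 1 - x := by linarith
        have e : (-1) / (1 - x) - 1 / x - ((2 * (-1)) * (p * (1 - p) + x * (1 - x)) -
          2 * (1 - p - x) * (1 * (1 - x) + x * (-1))) / (p * (1 - p) + x * (1 - x)) ^ 2
          = -((1 - p - x) ^ 2 * ((p - x) ^ 2 - 2 * (x * (1 - x))) /
            (x * (1 - x) * (p * (1 - p) + x * (1 - x)) ^ 2)) := by
          have := hSx.ne'
          have := h1x.ne'
          have := hxp.ne'
          field_simp
          ring
        rw [e, neg_lt_zero]
        have hu : 0 < (p - x) ^ 2 - 2 * (x * (1 - x)) := by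
          have ha : (2 * p - 1) ^ 2 < (p - x) ^ 2 :=
            pow_lt_pow_left₀ (by linarith) (by linarith) (by norm_num)
          have hb : 0 < (1 - p - x) * (p - x) := mul_pos (by linarith) (by linarith)
          nlinarith
        have hv : 0 < 1 - p - x := by linarith
        positivity
    have hlt := hanti (Set.left_mem_Icc.2 hq1.le) (Set.right_mem_Icc.2 hq1.le) hq1
    have hp : 0 < p := by linarith
    have e1 : hPB p q = f q - f (1 - p) := by
      simp only [hPB, f]
      have a1 : (1 - p) ≠ 0 := by linarith
      have a2 : (1 - q) ≠ 0 := by linarith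
      rw [Real.log_div (mul_ne_zero a1 a2) (mul_ne_zero hp.ne' hq0.ne'),
        Real.log_mul a1 a2, Real.log_mul hp.ne' hq0.ne', sub_self (1 - p), sub_sub_cancel]
      ring
    rw [e1]
    linarith
  exact ⟨main, fun ⟨q, hq, h⟩ => (main q hq).ne' h⟩
end

section
/- For all p, q ∈ [0,1]: if 𝒟(p,q) = 12pq(pq + p + q) − 14pq + p² + q² ≤ 0, then 𝒜(p,q) = 2pq − p(2p−1) − q(2q−1) ≥ 0. (Inclusion D ⊂ A of the corresponding parameter sets.) -/
/-- Inclusion `D ⊂ A`: for all `p, q ∈ [0,1]`, if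
`𝒟(p,q) = 12pq(pq + p + q) − 14pq + p² + q² ≤ 0`, then
`𝒜(p,q) = 2pq − p(2p−1) − q(2q−1) ≥ 0`. -/
theorem D_subset_A (p q : ℝ) (hp0 : 0 ≤ p) (hp1 : p ≤ 1) (hq0 : 0 ≤ q) (hq1 : q ≤ 1)
    (hD : 12*p*q*(p*q + p + q) - 14*p*q + p^2 + q^2 ≤ 0) :
    0 ≤ 2*p*q - p*(2*p - 1) - q*(2*q - 1) := by
  obtain ⟨s, hs⟩ : ∃ s, s = p + q := ⟨_, rfl⟩
  obtain ⟨m, hm⟩ : ∃ m, m = p * q := ⟨_, rfl⟩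
  have hs0 : 0 ≤ s := by rw [hs]; positivity
  have hm0 : 0 ≤ m := by rw [hm]; positivity
  have h4 : 4 * m ≤ s^2 := by rw [hs, hm]; nlinarith [sq_nonneg (p - q)]
  have hD' : 12*m^2 + 12*m*s - 16*m + s^2 ≤ 0 := by
    rw [hs, hm]; linarith
  suffices h : 0 ≤ 6*m - 2*s^2 + s by
    rw [hs, hm] at h; linarith
  rcases hm0.eq_or_lt with h0 | hpos
  · rw [← h0] at hD' ⊢
    have : s = 0 := by
      have : s^2 = 0 := le_antisymm (by linarith) (sq_nonneg s)
      exact pow_eq_zero_iff (two_ne_zero) |>.1 this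
    rw [this]; norm_num
  have hspos : 0 < s := by
    rcases hs0.eq_or_lt with h | h
    · rw [← h] at h4; linarith
    · exact h
  have h1 : m + s ≤ 1 := by
    by_contra hc
    have := mul_pos hpos (sub_pos.2 (not_le.1 hc))
    nlinarith
  by_contra hc
  push Not at hc
  obtain ⟨k, hk⟩ : ∃ k, k = (2*s^2 - s)/6 := ⟨_, rfl⟩
  have hmk : 0 < k - m := by rw [hk]; linarith
  have hv : 0 ≤ 16 - 12*s - 12*(m+k) := by
    have : 0 ≤ (1 - s) * (2 + s) := mul_nonneg (by linarith) (by linarith)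
    have : 24 * k ≤ 16 - 12*s := by rw [hk]; linarith
    linarith
  have hprod := mul_nonneg hmk.le hv
  have hDk : 12*k^2 + 12*k*s - 16*k + s^2 = s * (4*s^3+8*s^2-18*s+8)/3 := by
    rw [hk]; ring
  have hc3 : 0 < 4*s^3+8*s^2-18*s+8 := by
    nlinarith [mul_nonneg hs0 (sq_nonneg (s - 3/4)), sq_nonneg (s - 3/4)]
  have := mul_pos hspos hc3
  linarith
end

section
/- For every p ∈ [1/2, (3+√3)/6], the derivative g_{p,1−p}′(t) is negative for all t > 0 and positive for all t < 0; in particular the symmetric function g_{p,1−p} is strictly unimodal with unique maximum at t = 0. -/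
lemma aux_D_pos (b t : ℝ) (hb : 0 < b) : 0 < 1 - b + b * Real.cosh t := by
  nlinarith [Real.one_le_cosh t]

lemma aux_D_deriv (b t : ℝ) :
    HasDerivAt (fun t => 1 - b + b * Real.cosh t) (b * Real.sinh t) t :=
  ((Real.hasDerivAt_cosh t).const_mul b).const_add (1 - b)

lemma aux_f1 (b t : ℝ) (hb : 0 < b) :
    HasDerivAt (fun t => Real.log (1 - b + b * Real.cosh t))
      (b * Real.sinh t / (1 - b + b * Real.cosh t)) t :=
  (aux_D_deriv b t).log (aux_D_pos b t hb).ne'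

lemma aux_f2 (b t : ℝ) (hb : 0 < b) :
    HasDerivAt (fun t => b * Real.sinh t / (1 - b + b * Real.cosh t))
      (b * ((1 - b) * Real.cosh t + b) / (1 - b + b * Real.cosh t) ^ 2) t := by
  have hD := (aux_D_pos b t hb).ne'
  refine HasDerivAt.congr_deriv (((Real.hasDerivAt_sinh t).const_mul b).div (aux_D_deriv b t) hD) ?_
  have := Real.cosh_sq t
  congr 1
  linear_combination (b ^ 2) * this

lemma aux_f3 (b t : ℝ) (hb : 0 < b) :
    HasDerivAt (fun t => b * ((1 - b) * Real.cosh t + b) / (1 - b + b * Real.cosh t) ^ 2)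
      (b * Real.sinh t * ((1 - b) ^ 2 - (1 - b) * b * Real.cosh t - 2 * b ^ 2)
        / (1 - b + b * Real.cosh t) ^ 3) t := by
  have hD := (aux_D_pos b t hb).ne'
  refine HasDerivAt.congr_deriv
    (((((Real.hasDerivAt_cosh t).const_mul (1 - b)).add_const b).const_mul b).div
    ((aux_D_deriv b t).pow 2) (pow_ne_zero 2 hD)) ?_
  field_simp
  push_cast
  ring

lemma aux_k (b t : ℝ) (hb : 1 / 3 ≤ b) (hb1 : b < 1) (ht : 0 < t) :
    t * (b * ((1 - b) * Real.cosh t + b) / (1 - b + b * Real.cosh t) ^ 2)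
      - b * Real.sinh t / (1 - b + b * Real.cosh t) < 0 := by
  have hb0 : 0 < b := by linarith
  have hd : ∀ x : ℝ, HasDerivAt (fun t : ℝ =>
      t * (b * ((1 - b) * Real.cosh t + b) / (1 - b + b * Real.cosh t) ^ 2)
      - b * Real.sinh t / (1 - b + b * Real.cosh t))
      (x * (b * Real.sinh x * ((1 - b) ^ 2 - (1 - b) * b * Real.cosh x - 2 * b ^ 2)
        / (1 - b + b * Real.cosh x) ^ 3)) x := by
    intro x
    refine HasDerivAt.congr_deriv (((hasDerivAt_id' x).mul (aux_f3 b x hb0)).sub (aux_f2 b x hb0)) ?_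
    ring
  have hanti := strictAntiOn_of_deriv_neg (convex_Ici (0:ℝ))
    (fun x _ => (hd x).continuousAt.continuousWithinAt) (by
      intro x hx
      rw [interior_Ici] at hx
      have hx : 0 < x := hx
      rw [(hd x).deriv]
      have h1 : 1 < Real.cosh x := Real.one_lt_cosh.2 hx.ne'
      have h2 : 0 < Real.sinh x := Real.sinh_pos_iff.2 hx
      have h3 := aux_D_pos b x hb0
      have h4 : (1 - b) ^ 2 - (1 - b) * b * Real.cosh x - 2 * b ^ 2 < 0 := by
        nlinarith [mul_pos (mul_pos (sub_pos.2 hb1) hb0) (sub_pos.2 h1)]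
      exact mul_neg_of_pos_of_neg hx
        (div_neg_of_neg_of_pos (mul_neg_of_pos_of_neg (mul_pos hb0 h2) h4) (pow_pos h3 3)))
  have := hanti (Set.mem_Ici.2 le_rfl) (Set.mem_Ici.2 ht.le) ht
  simpa using this

lemma aux_h (b t : ℝ) (hb : 1 / 3 ≤ b) (hb1 : b < 1) (ht : 0 < t) :
    t * (b * Real.sinh t / (1 - b + b * Real.cosh t))
      - 2 * Real.log (1 - b + b * Real.cosh t) < 0 := by
  have hb0 : 0 < b := by linarith
  have hd : ∀ x : ℝ, HasDerivAt (fun t : ℝ =>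
      t * (b * Real.sinh t / (1 - b + b * Real.cosh t))
      - 2 * Real.log (1 - b + b * Real.cosh t))
      (x * (b * ((1 - b) * Real.cosh x + b) / (1 - b + b * Real.cosh x) ^ 2)
      - b * Real.sinh x / (1 - b + b * Real.cosh x)) x := by
    intro x
    refine HasDerivAt.congr_deriv (((hasDerivAt_id' x).mul (aux_f2 b x hb0)).sub ((aux_f1 b x hb0).const_mul 2)) ?_
    ring
  have hanti := strictAntiOn_of_deriv_neg (convex_Ici (0:ℝ))
    (fun x _ => (hd x).continuousAt.continuousWithinAt) (by
      intro x hx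
      rw [interior_Ici] at hx
      rw [(hd x).deriv]
      exact aux_k b x hb hb1 hx)
  have := hanti (Set.mem_Ici.2 le_rfl) (Set.mem_Ici.2 ht.le) ht
  simpa using this

lemma aux_G (p t : ℝ) :
    GPB p (1 - p) t = 1 - 2 * (p * (1 - p)) + 2 * (p * (1 - p)) * Real.cosh t := by
  have h : Real.exp (-t) * Real.exp t = 1 := by rw [← Real.exp_add]; simp
  unfold GPB
  rw [Real.cosh_eq, show -(t * (p + (1 - p))) = -t by ring]
  linear_combination (p * (1 - p) * Real.exp t + p ^ 2 + (1 - p) ^ 2) * h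

/-- For `p ∈ [1/2, (3+√3)/6]`, the derivative `g_{p,1−p}′(t)` is negative for all
`t > 0` and positive for all `t < 0`; in particular the symmetric function
`g_{p,1−p}` is strictly unimodal with unique maximum at `t = 0`. -/
theorem gPB_symmetric_unimodal (p : ℝ) (hp0 : 1/2 ≤ p) (hp1 : p ≤ (3 + Real.sqrt 3) / 6) :
    (∀ t > (0:ℝ), deriv (gPB p (1 - p)) t < 0) ∧
    (∀ t < (0:ℝ), 0 < deriv (gPB p (1 - p)) t) := by
  have hs : Real.sqrt 3 ^ 2 = 3 := Real.sq_sqrt (by norm_num)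
  have hs0 : 0 ≤ Real.sqrt 3 := Real.sqrt_nonneg 3
  have hb : 1 / 3 ≤ 2 * (p * (1 - p)) := by
    nlinarith [mul_nonneg (sub_nonneg.2 hp1) (by linarith : 0 ≤ p - (3 - Real.sqrt 3) / 6)]
  have hb1 : 2 * (p * (1 - p)) < 1 := by nlinarith [sq_nonneg (p - 1 / 2)]
  have main : ∀ t > (0:ℝ), deriv (gPB p (1 - p)) t < 0 := by
    intro t ht
    have he : gPB p (1 - p) =ᶠ[nhds t] fun t =>
        Real.log (1 - 2 * (p * (1 - p)) + 2 * (p * (1 - p)) * Real.cosh t) / t ^ 2 := by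
      filter_upwards [isOpen_ne.mem_nhds ht.ne'] with x hx
      have hx : x ≠ 0 := hx
      simp only [gPB, if_neg hx, aux_G]
    rw [he.deriv_eq]
    have hk := aux_h _ t hb hb1 ht
    generalize 2 * (p * (1 - p)) = b at *
    have hd := (aux_f1 b t (by linarith)).div ((hasDerivAt_id' t).pow 2) (pow_ne_zero 2 ht.ne')
    have hd2 := hd.deriv
    simp only [Pi.div_def, Pi.pow_def] at hd2
    rw [hd2]
    apply div_neg_of_neg_of_pos _ (by positivity)
    push_cast
    nlinarith [mul_neg_of_pos_of_neg ht hk]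
  refine ⟨main, fun t ht => ?_⟩
  have hev : gPB p (1 - p) = fun x => gPB p (1 - p) (-x) := by
    funext x
    simp only [gPB, aux_G, Real.cosh_neg, neg_eq_zero, neg_sq]
  rw [hev, deriv_comp_neg]
  have := main (-t) (by linarith)
  linarith
end

section
/- For every p ∈ ((3+√3)/6, 1), there exists t† > 0 such that g_{p,1−p}′(t) > 0 for all t ∈ (0, t†), g_{p,1−p}′(t†) = 0, and g_{p,1−p}′(t) < 0 for all t > t†; in particular g_{p,1−p} is not strictly unimodal. -/
lemma aux_shape (F F' : ℝ → ℝ) (hF : ∀ t, HasDerivAt F (F' t) t) (h0 : F 0 = 0) (s : ℝ) (hs : 0 < s)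
    (hpos : ∀ t ∈ Set.Ioo 0 s, 0 < F' t) (hneg : ∀ t > s, F' t < 0)
    (T : ℝ) (hT : 0 < T) (hFT : F T < 0) :
    ∃ r > (0:ℝ), (∀ t ∈ Set.Ioo 0 r, 0 < F t) ∧ F r = 0 ∧ (∀ t > r, F t < 0) := by
  have hc : Continuous F := continuous_iff_continuousAt.2 fun t => (hF t).continuousAt
  have hinc : StrictMonoOn F (Set.Icc 0 s) := by
    apply strictMonoOn_of_deriv_pos (convex_Icc 0 s) hc.continuousOn
    intro x hx
    rw [interior_Icc] at hx
    rw [(hF x).deriv]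
    exact hpos x hx
  have hdec : StrictAntiOn F (Set.Ici s) := by
    apply strictAntiOn_of_deriv_neg (convex_Ici s) hc.continuousOn
    intro x hx
    rw [interior_Ici] at hx
    rw [(hF x).deriv]
    exact hneg x hx
  have hp1 : ∀ t, 0 < t → t ≤ s → 0 < F t := by
    intro t h1 h2
    have := hinc ⟨le_refl 0, hs.le⟩ ⟨h1.le, h2⟩ h1
    rwa [h0] at this
  have hsT : s < T := by
    by_contra! h
    linarith [hp1 T hT h]
  obtain ⟨r, hr, hr0⟩ := intermediate_value_Icc' hsT.le hc.continuousOn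
    (show (0:ℝ) ∈ Set.Icc (F T) (F s) from ⟨hFT.le, (hp1 s hs le_rfl).le⟩)
  refine ⟨r, by linarith [hr.1], ?_, hr0, ?_⟩
  · intro t ht
    rcases le_or_gt t s with h | h
    · exact hp1 t ht.1 h
    · have := hdec (Set.mem_Ici.2 h.le) (Set.mem_Ici.2 hr.1) ht.2
      rwa [hr0] at this
  · intro t ht
    have := hdec (Set.mem_Ici.2 hr.1) (Set.mem_Ici.2 (hr.1.trans (le_of_lt ht))) ht
    rwa [hr0] at this

lemma aux_main (b c : ℝ) (hb : 0 < b) (hc : 0 < c) (hbc : b + c = 1) (h2 : 2 * c < b) :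
    ∃ r > (0:ℝ),
      (∀ t ∈ Set.Ioo 0 r, 0 < t * (c * Real.sinh t / (b + c * Real.cosh t))
        - 2 * Real.log (b + c * Real.cosh t)) ∧
      r * (c * Real.sinh r / (b + c * Real.cosh r)) - 2 * Real.log (b + c * Real.cosh r) = 0 ∧
      (∀ t > r, t * (c * Real.sinh t / (b + c * Real.cosh t))
        - 2 * Real.log (b + c * Real.cosh t) < 0) := by
  have hD : ∀ t, 0 < b + c * Real.cosh t := fun t => by
    have := Real.cosh_pos t
    positivity
  have dD : ∀ t, HasDerivAt (fun t => b + c * Real.cosh t) (c * Real.sinh t) t := fun t =>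
    ((Real.hasDerivAt_cosh t).const_mul c).const_add b
  have d1 : ∀ t, HasDerivAt (fun t => Real.log (b + c * Real.cosh t))
      (c * Real.sinh t / (b + c * Real.cosh t)) t := fun t => (dD t).log (hD t).ne'
  have d2 : ∀ t, HasDerivAt (fun t => c * Real.sinh t / (b + c * Real.cosh t))
      (c * (b * Real.cosh t + c) / (b + c * Real.cosh t) ^ 2) t := fun t => by
    refine HasDerivAt.congr_deriv (((Real.hasDerivAt_sinh t).const_mul c).div (dD t) (hD t).ne') ?_
    congr 1
    linear_combination (c^2) * Real.cosh_sq t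
  have d3 : ∀ t, HasDerivAt (fun t => c * (b * Real.cosh t + c) / (b + c * Real.cosh t) ^ 2)
      (c * Real.sinh t * (b ^ 2 - 2 * c ^ 2 - b * c * Real.cosh t) / (b + c * Real.cosh t) ^ 3) t :=
    fun t => by
    refine HasDerivAt.congr_deriv (((((Real.hasDerivAt_cosh t).const_mul b).add_const c).const_mul c).div ((dD t).pow 2)
      (pow_pos (hD t) 2).ne') ?_
    have := (hD t).ne'
    try simp only [Pi.pow_apply]
    field_simp
    push_cast
    ring
  have dN : ∀ t, HasDerivAt (fun t => t * (c * Real.sinh t / (b + c * Real.cosh t))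
        - 2 * Real.log (b + c * Real.cosh t))
      (t * (c * (b * Real.cosh t + c) / (b + c * Real.cosh t) ^ 2)
        - c * Real.sinh t / (b + c * Real.cosh t)) t := fun t => by
    refine HasDerivAt.congr_deriv (((hasDerivAt_id t).mul (d2 t)).sub ((d1 t).const_mul 2)) ?_
    try simp only [id]
    ring
  have dN' : ∀ t, HasDerivAt (fun t => t * (c * (b * Real.cosh t + c) / (b + c * Real.cosh t) ^ 2)
        - c * Real.sinh t / (b + c * Real.cosh t))
      (t * (c * Real.sinh t * (b ^ 2 - 2 * c ^ 2 - b * c * Real.cosh t)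
        / (b + c * Real.cosh t) ^ 3)) t := fun t => by
    refine HasDerivAt.congr_deriv (((hasDerivAt_id t).mul (d3 t)).sub (d2 t)) ?_
    try simp only [id]
    ring
  -- large T
  obtain ⟨T, hT, hNT⟩ : ∃ T > (0:ℝ), T * (c * Real.sinh T / (b + c * Real.cosh T))
        - 2 * Real.log (b + c * Real.cosh T) < 0 := by
    refine ⟨|2 * Real.log (c / 2)| + 1, by positivity, ?_⟩
    set T := |2 * Real.log (c / 2)| + 1 with hTd
    have hT : 0 < T := by positivity
    have e1 : c * Real.sinh T / (b + c * Real.cosh T) < 1 := by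
      rw [div_lt_one (hD T)]
      nlinarith [Real.sinh_lt_cosh T]
    have e2 : Real.log (c / 2) + T ≤ Real.log (b + c * Real.cosh T) := by
      have : Real.log (c / 2 * Real.exp T) = Real.log (c / 2) + T := by
        rw [Real.log_mul (by positivity) (Real.exp_pos T).ne', Real.log_exp]
      rw [← this]
      apply Real.log_le_log (by positivity)
      rw [Real.cosh_eq]
      nlinarith [mul_pos hc (Real.exp_pos (-T))]
    have e3 := neg_abs_le (2 * Real.log (c / 2))
    nlinarith
  -- first level
  obtain ⟨s, hs, hsc⟩ : ∃ s > (0:ℝ), b ^ 2 - 2 * c ^ 2 - b * c * Real.cosh s = 0 := by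
    have hk : 1 < (b ^ 2 - 2 * c ^ 2) / (b * c) := by
      rw [lt_div_iff₀ (by positivity)]
      nlinarith
    refine ⟨Real.arcosh ((b ^ 2 - 2 * c ^ 2) / (b * c)), Real.arcosh_pos hk, ?_⟩
    rw [Real.cosh_arcosh hk.le]
    field_simp
    ring
  obtain ⟨T', hT', hNT'⟩ : ∃ T' > (0:ℝ), T' * (c * (b * Real.cosh T' + c)
        / (b + c * Real.cosh T') ^ 2) - c * Real.sinh T' / (b + c * Real.cosh T') < 0 := by
    obtain ⟨x, hx, hxe⟩ := exists_hasDerivAt_eq_slope _ _ hT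
      (continuous_iff_continuousAt.2 fun t => (dN t).continuousAt).continuousOn
      (fun x _ => dN x)
    refine ⟨x, hx.1, ?_⟩
    rw [hxe]
    apply div_neg_of_neg_of_pos _ (by linarith)
    simpa [hbc] using hNT
  obtain ⟨r, hr, hr1, -, hr3⟩ := aux_shape _ _ dN' (by simp) s hs
    (fun t ht => by
      have h1 := Real.sinh_pos_iff.2 ht.1
      have h3 : Real.cosh t < Real.cosh s :=
        Real.cosh_lt_cosh.2 (by rw [abs_of_pos ht.1, abs_of_pos hs]; exact ht.2)
      have h4 : 0 < b ^ 2 - 2 * c ^ 2 - b * c * Real.cosh t := by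
        nlinarith [mul_pos hb hc]
      have := hD t
      have := ht.1
      positivity)
    (fun t ht => by
      have ht0 : 0 < t := lt_trans hs ht
      have h1 := Real.sinh_pos_iff.2 ht0
      have h3 : Real.cosh s < Real.cosh t :=
        Real.cosh_lt_cosh.2 (by rw [abs_of_pos ht0, abs_of_pos hs]; exact ht)
      have h4 : b ^ 2 - 2 * c ^ 2 - b * c * Real.cosh t < 0 := by
        nlinarith [mul_pos hb hc]
      have := hD t
      apply mul_neg_of_pos_of_neg ht0
      apply div_neg_of_neg_of_pos _ (by positivity)
      exact mul_neg_of_pos_of_neg (by positivity) h4)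
    T' hT' hNT'
  exact aux_shape _ _ dN (by simp [hbc]) r hr hr1 hr3 T hT hNT

theorem gPB_symmetric_not_unimodal (p : ℝ) (hp0 : (3 + Real.sqrt 3) / 6 < p) (hp1 : p < 1) :
    ∃ tdag > (0:ℝ),
      (∀ t ∈ Set.Ioo 0 tdag, 0 < deriv (gPB p (1 - p)) t) ∧
      deriv (gPB p (1 - p)) tdag = 0 ∧
      (∀ t > tdag, deriv (gPB p (1 - p)) t < 0) := by
  have hs3 : 0 ≤ Real.sqrt 3 := Real.sqrt_nonneg 3
  have hs3' : Real.sqrt 3 ^ 2 = 3 := Real.sq_sqrt (by norm_num)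
  have hp : 0 < p := by linarith
  have ha : 0 < p * (1 - p) := mul_pos hp (by linarith)
  have ha6 : p * (1 - p) < 1 / 6 := by nlinarith
  obtain ⟨r, hr, h1, h2, h3⟩ := aux_main (1 - 2 * (p * (1 - p))) (2 * (p * (1 - p)))
    (by linarith) (by linarith) (by ring) (by linarith)
  set c := 2 * (p * (1 - p)) with hcd
  have key : ∀ t, 0 < t → deriv (gPB p (1 - p)) t =
      (t * (c * Real.sinh t / ((1 - c) + c * Real.cosh t))
        - 2 * Real.log ((1 - c) + c * Real.cosh t)) / t ^ 3 := by
    intro t ht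
    have hG : ∀ u, GPB p (1 - p) u = (1 - c) + c * Real.cosh u := by
      intro u
      have he : Real.exp (-u) * Real.exp u = 1 := by rw [← Real.exp_add]; simp
      unfold GPB
      rw [Real.cosh_eq, hcd, show -(u * (p + (1 - p))) = -u by ring]
      linear_combination (p * (1 - p) * Real.exp u + p ^ 2 + (1 - p) ^ 2) * he
    have hev : gPB p (1 - p) =ᶠ[nhds t]
        fun u => Real.log ((1 - c) + c * Real.cosh u) / u ^ 2 := by
      filter_upwards [lt_mem_nhds ht] with u hu
      unfold gPB
      rw [if_neg (ne_of_gt hu), hG]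
    have hD : 0 < (1 - c) + c * Real.cosh t := by
      have := Real.cosh_pos t
      have : 0 < c := by linarith
      have : 0 < 1 - c := by linarith
      positivity
    rw [hev.deriv_eq]
    have := (((((Real.hasDerivAt_cosh t).const_mul c).const_add (1 - c)).log hD.ne').div
      (hasDerivAt_pow 2 t) (pow_pos ht 2).ne').deriv
    refine Eq.trans this ?_
    have hD' := hD.ne'
    have ht' := ht.ne'
    field_simp
    push_cast
    ring
  refine ⟨r, hr, ?_, ?_, ?_⟩
  · intro t ht
    rw [key t ht.1]
    exact div_pos (h1 t ht) (pow_pos ht.1 3)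
  · rw [key r hr, h2, zero_div]
  · intro t ht
    rw [key t (lt_trans hr ht)]
    exact div_neg_of_neg_of_pos (h3 t ht) (pow_pos (lt_trans hr ht) 3)
end

section
/- For every t > 0 and all p, q ∈ (0, p_t), where p_t = 1/(1 + exp(t/2)), one has g_{p,q}′(t) > 0 (equivalently, f_{p,q}(t) = t³·g_{p,q}′(t) > 0). -/
theorem sinh_aux (y a : ℝ) (hy : 0 < y) (hya : y < a) :
    a * Real.sinh y < y * Real.sinh a := by
  have hc : StrictConvexOn ℝ (Set.Ici (0:ℝ)) Real.sinh := by
    apply StrictMonoOn.strictConvexOn_of_deriv (convex_Ici 0) Real.continuous_sinh.continuousOn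
    rw [Real.deriv_sinh]
    intro x hx z hz hxz
    rw [interior_Ici, Set.mem_Ioi] at hx hz
    rw [Real.cosh_lt_cosh, abs_of_pos hx, abs_of_pos hz]
    exact hxz
  have ha : 0 < a := hy.trans hya
  have h := hc.2 (Set.mem_Ici.2 le_rfl) (Set.mem_Ici.2 ha.le) ha.ne
    (show 0 < 1 - y / a by rw [sub_pos, div_lt_one ha]; exact hya) (show 0 < y / a by positivity)
    (by ring)
  simp only [smul_eq_mul, mul_zero, zero_add, Real.sinh_zero] at h
  rw [div_mul_cancel₀ _ ha.ne', div_mul_eq_mul_div, lt_div_iff₀ ha] at h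
  linarith

theorem key_aux (t p : ℝ) (ht : 0 < t) (hp0 : 0 < p) (hp : p < 1 / (1 + Real.exp (t / 2))) :
    0 < t * (-p + p * Real.exp t / (1 + p * (Real.exp t - 1)))
      - 2 * (-(t * p) + Real.log (1 + p * (Real.exp t - 1))) := by
  obtain ⟨a, rfl⟩ : ∃ a, t = 2 * a := ⟨t / 2, by ring⟩
  have ha : 0 < a := by linarith
  have e1 : 2 * a / 2 = a := by ring
  rw [e1] at hp
  have e2 : Real.exp (2 * a) = Real.exp a ^ 2 := by
    rw [← Real.exp_nat_mul]; norm_num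
  rw [e2]
  have hs : 1 < Real.exp a := Real.one_lt_exp_iff.2 ha
  have hy := sinh_aux (a - Real.log (1 + p * (Real.exp a ^ 2 - 1))) a
  have hse : Real.log (Real.exp a) = a := Real.log_exp a
  rw [Real.sinh_eq, Real.sinh_eq, neg_sub, Real.exp_sub, Real.exp_sub, Real.exp_neg] at hy
  generalize Real.exp a = s at *
  have hu1 : 1 < 1 + p * (s ^ 2 - 1) := by
    have : 0 < p * (s ^ 2 - 1) := mul_pos hp0 (by nlinarith)
    linarith
  rw [lt_div_iff₀ (by linarith)] at hp
  have hus : 1 + p * (s ^ 2 - 1) < s := by nlinarith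
  rw [Real.exp_log (by linarith)] at hy
  obtain ⟨u, hu⟩ : ∃ u, u = 1 + p * (s ^ 2 - 1) := ⟨_, rfl⟩
  rw [← hu] at hu1 hus hy ⊢
  have hl1 : 0 < Real.log u := Real.log_pos hu1
  have hl2 : Real.log u < a := by
    rw [← hse]; exact Real.log_lt_log (by linarith) hus
  have hy := hy (by linarith) (by linarith)
  generalize Real.log u = L at *
  have hs2 : 0 < s ^ 2 - 1 := by nlinarith
  have hpe : p = (u - 1) / (s ^ 2 - 1) := by
    rw [eq_div_iff hs2.ne']; linarith
  have hu0 : 0 < u := by linarith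
  have hs0 : 0 < s := by linarith
  have e3 : 2 * a * (-p + p * s ^ 2 / u) - 2 * (-(2 * a * p) + L)
      = 4 * s / (s ^ 2 - 1) * ((a - L) * ((s - s⁻¹) / 2) - a * ((s / u - u / s) / 2)) := by
    rw [hpe]
    field_simp
    ring
  rw [e3]
  exact mul_pos (by positivity) (by linarith)

/-- For every `t > 0` and all `p, q ∈ (0, p_t)` with `p_t = 1/(1 + exp(t/2))`,
one has `g_{p,q}′(t) > 0`. -/
theorem gPB_deriv_pos_small_params (t p q : ℝ) (ht : 0 < t)
    (hp0 : 0 < p) (hp : p < 1 / (1 + Real.exp (t / 2)))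
    (hq0 : 0 < q) (hq : q < 1 / (1 + Real.exp (t / 2))) :
    0 < deriv (gPB p q) t := by
  have pos : ∀ r x : ℝ, 0 < r → 0 < x → 0 < 1 + r * (Real.exp x - 1) := by
    intro r x hr hx
    have := mul_pos hr (sub_pos.2 (Real.one_lt_exp_iff.2 hx))
    linarith
  have hev : gPB p q =ᶠ[nhds t] fun x =>
      ((-(x * p) + Real.log (1 + p * (Real.exp x - 1)))
        + (-(x * q) + Real.log (1 + q * (Real.exp x - 1)))) / x ^ 2 := by
    filter_upwards [lt_mem_nhds ht] with x hx
    have h1 := pos p x hp0 hx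
    have h2 := pos q x hq0 hx
    rw [gPB, if_neg hx.ne', GPB, Real.log_mul (by positivity) h2.ne',
      Real.log_mul (by positivity) h1.ne', Real.log_exp]
    congr 1
    ring
  have hd : ∀ r : ℝ, 0 < r → HasDerivAt (fun x => -(x * r) + Real.log (1 + r * (Real.exp x - 1)))
      (-r + r * Real.exp t / (1 + r * (Real.exp t - 1))) t := by
    intro r hr
    have h1 := (((((Real.hasDerivAt_exp t).sub_const 1).const_mul r).const_add 1).log
      (pos r t hr ht).ne')
    have h2 := ((hasDerivAt_id t).mul_const r).neg
    rw [one_mul] at h2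
    exact h2.add h1
  have hD := ((hd p hp0).add (hd q hq0)).div (hasDerivAt_pow 2 t) (by positivity)
  have hD' := hD.congr_of_eventuallyEq hev
  rw [hD'.deriv]
  apply div_pos _ (by positivity)
  have kp := key_aux t p ht hp0 hp
  have kq := key_aux t q ht hq0 hq
  have := mul_pos ht (add_pos kp kq)
  simp only [Pi.add_apply]
  norm_num
  linarith
end

section
/- For every p ∈ (0, (3+√3)/6) there exists γ ∈ [0, min(p, 1−p)) such that for every q ∈ (0, min(p, 1−p)): the derivative g_{p,q}′(t) is positive for all t ∈ (0, t*_{p,q}) if and only if q > γ. -/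
noncomputable def FF (t q : ℝ) : ℝ :=
  t * (q * Real.exp t / (1 + q * (Real.exp t - 1))) - 2 * Real.log (1 + q * (Real.exp t - 1)) + q * t

lemma FF_w_pos {t q : ℝ} (ht : 0 < t) (hq : 0 ≤ q) : 0 < 1 + q * (Real.exp t - 1) := by
  have : 1 < Real.exp t := Real.one_lt_exp_iff.mpr ht
  have : 0 ≤ q * (Real.exp t - 1) := mul_nonneg hq (by linarith)
  linarith

lemma FF_hasDerivAt {t q : ℝ} (ht : 0 < t) (hq : 0 ≤ q) :
    HasDerivAt (FF t) ((t * (1 + q * (Real.exp t - 1))^2 - 2 * (Real.exp t - 1) * (1 + q * (Real.exp t - 1)) + t * Real.exp t) / (1 + q * (Real.exp t - 1))^2) q := by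
  have hw := FF_w_pos ht hq
  have h1 : HasDerivAt (fun q : ℝ => 1 + q * (Real.exp t - 1)) (Real.exp t - 1) q := by
    simpa using ((hasDerivAt_id q).mul_const (Real.exp t - 1)).const_add 1
  have h2 : HasDerivAt (fun q : ℝ => q * Real.exp t) (Real.exp t) q := by
    simpa using (hasDerivAt_id q).mul_const (Real.exp t)
  have h3 : HasDerivAt (fun q : ℝ => q * t) t q := by
    simpa using (hasDerivAt_id q).mul_const t
  have := (((h2.div h1 hw.ne').const_mul t).sub ((h1.log hw.ne').const_mul 2)).add h3
  refine this.congr_deriv ?_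
  field_simp
  ring

lemma t_sqrt_lt {t : ℝ} (ht : 0 < t) : t * Real.exp (t/2) < Real.exp t - 1 := by
  have h := Real.self_lt_sinh_iff.mpr (half_pos ht)
  rw [Real.sinh_eq] at h
  have e1 : Real.exp t = Real.exp (t/2) * Real.exp (t/2) := by rw [← Real.exp_add]; ring_nf
  have e2 : Real.exp (t/2) * Real.exp (-(t/2)) = 1 := by rw [← Real.exp_add]; simp
  have := Real.exp_pos (t/2)
  nlinarith

lemma FF_quasi {t a b c : ℝ} (ht : 0 < t) (ha : 0 ≤ a) (hab : a < b) (hbc : b < c)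
    (hc : c * (1 + Real.exp (t/2)) ≤ 1) (h1 : FF t b ≤ FF t a) (h2 : FF t b ≤ FF t c) : False := by
  have cont : ∀ u v : ℝ, 0 ≤ u → ContinuousOn (FF t) (Set.Icc u v) := fun u v hu x hx =>
    (FF_hasDerivAt ht (hu.trans hx.1)).continuousAt.continuousWithinAt
  obtain ⟨y, hy, hye⟩ := exists_hasDerivAt_eq_slope (FF t) _ hab (cont a b ha)
    (fun x hx => FF_hasDerivAt ht (ha.trans hx.1.le))
  obtain ⟨z, hz, hze⟩ := exists_hasDerivAt_eq_slope (FF t) _ hbc (cont b c (ha.trans hab.le))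
    (fun x hx => FF_hasDerivAt ht ((ha.trans hab.le).trans hx.1.le))
  have hy0 : 0 ≤ y := ha.trans hy.1.le
  have hz0 : 0 ≤ z := (ha.trans hab.le).trans hz.1.le
  have wy := FF_w_pos ht hy0
  have wz := FF_w_pos ht hz0
  have hyz : y < z := hy.2.trans hz.1
  have s1 : (FF t b - FF t a) / (b - a) ≤ 0 := div_nonpos_of_nonpos_of_nonneg (by linarith) (by linarith)
  have s2 : 0 ≤ (FF t c - FF t b) / (c - b) := div_nonneg (by linarith) (by linarith)
  rw [← hye] at s1
  rw [← hze] at s2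
  have hx1 : 1 < Real.exp t := Real.one_lt_exp_iff.mpr ht
  have key := t_sqrt_lt ht
  have e1 : Real.exp t = Real.exp (t/2) * Real.exp (t/2) := by rw [← Real.exp_add]; ring_nf
  set r := Real.exp (t/2) with hr
  have r1 : 1 < r := Real.one_lt_exp_iff.mpr (half_pos ht)
  have n1 : t * (1 + y * (Real.exp t - 1))^2 - 2 * (Real.exp t - 1) * (1 + y * (Real.exp t - 1)) + t * Real.exp t ≤ 0 := by
    by_contra hcon
    push Not at hcon
    exact absurd s1 (not_le.mpr (div_pos hcon (by positivity)))
  have n2 : 0 ≤ t * (1 + z * (Real.exp t - 1))^2 - 2 * (Real.exp t - 1) * (1 + z * (Real.exp t - 1)) + t * Real.exp t := by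
    by_contra hcon
    push Not at hcon
    exact absurd s2 (not_le.mpr (div_neg_of_neg_of_pos hcon (by positivity)))
  have hzr : 1 + z * (Real.exp t - 1) ≤ r := by
    have : z * (1 + r) ≤ 1 := by nlinarith [hz.2]
    rw [e1]; nlinarith
  have hyr : 1 + y * (Real.exp t - 1) < 1 + z * (Real.exp t - 1) := by
    have := mul_lt_mul_of_pos_right hyz (sub_pos.mpr hx1)
    linarith
  generalize 1 + z * (Real.exp t - 1) = Z at *
  generalize 1 + y * (Real.exp t - 1) = Y at *
  have : t * (Y + Z) < 2 * (Real.exp t - 1) := by nlinarith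
  nlinarith

lemma FF_reflect {t p q : ℝ} (ht : 0 < t) (hp : 0 < p) (hp1 : p < 1) 
    (hq : q * (1 + p * (Real.exp t - 1)) = 1 - p) : FF t p + FF t q = 0 := by
  have wp := FF_w_pos ht hp.le
  have hw : 1 + q * (Real.exp t - 1) = Real.exp t / (1 + p * (Real.exp t - 1)) := by
    rw [eq_div_iff wp.ne']
    linear_combination (Real.exp t - 1) * hq
  have hq' : q = (1 - p) / (1 + p * (Real.exp t - 1)) := by field_simp; linarith
  have hx := Real.exp_pos t
  unfold FF
  rw [hw, Real.log_div hx.ne' wp.ne', Real.log_exp, hq']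
  field_simp
  ring

lemma FF_zero (t : ℝ) : FF t 0 = 0 := by simp [FF]

lemma FF_up {t p s q : ℝ} (ht : 0 < t) (hp0 : 0 < p) (hp1 : p < 1) (hs : 0 < s) (hsq : s < q) (hqp : q < p)
    (htq : Real.exp t * (p * q) < (1 - p) * (1 - q)) (h : 0 < FF t p + FF t s) : 0 < FF t p + FF t q := by
  have e1 : Real.exp t = Real.exp (t/2) * Real.exp (t/2) := by rw [← Real.exp_add]; ring_nf
  have r1 : 1 < Real.exp (t/2) := Real.one_lt_exp_iff.mpr (half_pos ht)
  have wp := FF_w_pos ht hp0.le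
  by_contra hcon
  push Not at hcon
  rcases le_or_gt (p * (1 + Real.exp (t/2))) 1 with hc | hc
  · set c := 1 / (1 + Real.exp (t/2)) with hcd
    have c0 : c * (1 + Real.exp (t/2)) = 1 := by rw [hcd]; field_simp
    have cpos : 0 < c := by positivity
    have c1 : c < 1 := by nlinarith
    have hFc : FF t c = 0 := by
      have := FF_reflect (t := t) (p := c) (q := c) ht cpos c1 (by rw [e1]; linear_combination (c * (Real.exp (t/2) - 1) + 1) * c0)
      linarith
    have hpc : p ≤ c := by by_contra hh; push Not at hh; nlinarith
    have pos : ∀ y, 0 < y → y < c → 0 < FF t y := fun y hy hyc => by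
      by_contra hh
      push Not at hh
      exact FF_quasi ht le_rfl hy hyc c0.le (by rwa [FF_zero]) (by rwa [hFc])
    have hq := pos q (by linarith) (by linarith)
    have hpp : 0 ≤ FF t p := by
      rcases hpc.lt_or_eq with h | h
      · exact (pos p hp0 h).le
      · rw [h, hFc]
    linarith
  · set c := (1 - p) / (1 + p * (Real.exp t - 1)) with hcd
    have hc0 : c * (1 + p * (Real.exp t - 1)) = 1 - p := by rw [hcd]; field_simp
    have hr := FF_reflect ht hp0 hp1 hc0
    refine FF_quasi (c := c) ht hs.le hsq ?_ ?_ (by linarith) (by linarith)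
    · rw [hcd, lt_div_iff₀ wp]; nlinarith
    · rw [hcd, div_mul_eq_mul_div, div_le_one wp, e1]
      nlinarith
noncomputable def HH (T D t : ℝ) : ℝ :=
  t * (Real.sinh (t - T) / (Real.cosh (t - T) + D) - Real.sinh T / (Real.cosh T + D))
   - 2 * (Real.log (Real.cosh (t - T) + D) - Real.log (Real.cosh T + D))

noncomputable def HH1 (T D t : ℝ) : ℝ :=
  t * ((1 + Real.cosh (t - T) * D) / (Real.cosh (t - T) + D)^2)
   - Real.sinh (t - T) / (Real.cosh (t - T) + D) - Real.sinh T / (Real.cosh T + D)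

noncomputable def HH2 (T D t : ℝ) : ℝ :=
  t * (Real.sinh (t - T) * (D^2 - 2 - Real.cosh (t - T) * D) / (Real.cosh (t - T) + D)^3)

lemma cD_pos {D : ℝ} (hD : 0 < D) (u : ℝ) : 0 < Real.cosh u + D := by
  have := Real.cosh_pos u; linarith

lemma hasDerivAt_sh (T t : ℝ) : HasDerivAt (fun t => Real.sinh (t - T)) (Real.cosh (t - T)) t := by
  simpa using ((hasDerivAt_id t).sub_const T).sinh
lemma hasDerivAt_ch (T t : ℝ) : HasDerivAt (fun t => Real.cosh (t - T)) (Real.sinh (t - T)) t := by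
  simpa using ((hasDerivAt_id t).sub_const T).cosh

lemma HH_hasDerivAt {T D : ℝ} (hD : 0 < D) (t : ℝ) : HasDerivAt (HH T D) (HH1 T D t) t := by
  have hp := cD_pos hD (t - T)
  have h1 := (hasDerivAt_ch T t).add_const D
  have := ((hasDerivAt_id t).mul (((hasDerivAt_sh T t).div h1 hp.ne').sub_const
    (Real.sinh T / (Real.cosh T + D)))).sub
    (((h1.log hp.ne').sub_const (Real.log (Real.cosh T + D))).const_mul 2)
  refine this.congr_deriv ?_
  have hs := Real.cosh_sq (t - T)
  simp only [HH1, id, Pi.div_apply]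
  generalize Real.sinh T / (Real.cosh T + D) = R
  field_simp
  linear_combination t * hs

lemma HH1_hasDerivAt {T D : ℝ} (hD : 0 < D) (t : ℝ) : HasDerivAt (HH1 T D) (HH2 T D t) t := by
  have hp := cD_pos hD (t - T)
  have h1 := (hasDerivAt_ch T t).add_const D
  have := (((hasDerivAt_id t).mul ((((hasDerivAt_ch T t).mul_const D).const_add 1).div (h1.pow 2)
    (pow_ne_zero 2 hp.ne'))).sub ((hasDerivAt_sh T t).div h1 hp.ne')).sub_const
    (Real.sinh T / (Real.cosh T + D))
  refine this.congr_deriv ?_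
  have hs := Real.cosh_sq (t - T)
  simp only [HH2, id, Pi.div_apply, Pi.pow_apply]
  field_simp
  push_cast
  linear_combination (-(Real.cosh (t - T) + D)^2) * hs

lemma HH_zero (T D : ℝ) : HH T D 0 = 0 := by simp [HH]
lemma HH1_zero {T D : ℝ} : HH1 T D 0 = 0 := by simp [HH1, neg_div]
lemma HH_end (T D : ℝ) : HH T D (2 * T) = 0 := by
  have : 2 * T - T = T := by ring
  simp [HH, this]

lemma HH_cont {T D : ℝ} (hD : 0 < D) : Continuous (HH T D) :=
  continuous_iff_continuousAt.mpr fun t => (HH_hasDerivAt hD t).continuousAt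
lemma HH1_cont {T D : ℝ} (hD : 0 < D) : Continuous (HH1 T D) :=
  continuous_iff_continuousAt.mpr fun t => (HH1_hasDerivAt hD t).continuousAt

lemma HH_mvt {T D : ℝ} (hD : 0 < D) {a b : ℝ} (hab : a < b) :
    ∃ c ∈ Set.Ioo a b, HH T D b - HH T D a = HH1 T D c * (b - a) := by
  obtain ⟨c, hc, h⟩ := exists_hasDerivAt_eq_slope (HH T D) _ hab (HH_cont hD).continuousOn
    (fun x _ => HH_hasDerivAt hD x)
  exact ⟨c, hc, by rw [h]; have : b - a ≠ 0 := by linarith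
                   field_simp⟩
lemma HH1_mvt {T D : ℝ} (hD : 0 < D) {a b : ℝ} (hab : a < b) :
    ∃ c ∈ Set.Ioo a b, HH1 T D b - HH1 T D a = HH2 T D c * (b - a) := by
  obtain ⟨c, hc, h⟩ := exists_hasDerivAt_eq_slope (HH1 T D) _ hab (HH1_cont hD).continuousOn
    (fun x _ => HH1_hasDerivAt hD x)
  exact ⟨c, hc, by rw [h]; have : b - a ≠ 0 := by linarith
                   field_simp⟩

lemma cosh_lt_of {x y : ℝ} (h : |x| < |y|) : Real.cosh x < Real.cosh y := Real.cosh_lt_cosh.mpr h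

-- Lemma B
lemma HH_pos_left {T D t : ℝ} (hD : 0 < D) (ht : 0 < t) (htT : t ≤ T)
    (h : D^2 - 2 - Real.cosh (t - T) * D ≤ 0) : 0 < HH T D t := by
  obtain ⟨c, hc, e⟩ := HH_mvt (T := T) hD ht
  obtain ⟨c', hc', e'⟩ := HH1_mvt (T := T) hD hc.1
  rw [HH_zero] at e
  rw [HH1_zero] at e'
  have hp := cD_pos hD (c' - T)
  have hs : Real.sinh (c' - T) < 0 := Real.sinh_neg_iff.mpr (by linarith [hc.2, hc'.2])
  have hch : Real.cosh (t - T) < Real.cosh (c' - T) := cosh_lt_of (by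
    rw [abs_of_nonpos (by linarith), abs_of_neg (by linarith [hc.2, hc'.2])]; linarith [hc.2, hc'.2])
  have h2 : 0 < HH2 T D c' := by
    unfold HH2
    have : D^2 - 2 - Real.cosh (c' - T) * D < 0 := by nlinarith
    have := mul_pos_of_neg_of_neg hs this
    have := hc'.1
    positivity
  have h1 : 0 < HH1 T D c := by nlinarith [hc.1]
  nlinarith

-- Lemma A
lemma HH_neg_mid {T D : ℝ} (hD : 0 < D) (hT : 0 < T)
    (h : 0 ≤ D^2 - 2 - Real.cosh T * D) : HH T D T < 0 := by
  obtain ⟨c, hc, e⟩ := HH_mvt (T := T) hD hT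
  obtain ⟨c', hc', e'⟩ := HH1_mvt (T := T) hD hc.1
  rw [HH_zero] at e
  rw [HH1_zero] at e'
  have hp := cD_pos hD (c' - T)
  have hs : Real.sinh (c' - T) < 0 := Real.sinh_neg_iff.mpr (by linarith [hc.2, hc'.2])
  have hch : Real.cosh (c' - T) < Real.cosh T := cosh_lt_of (by
    rw [abs_of_pos hT, abs_of_neg (by linarith [hc.2, hc'.2])]; linarith [hc.2, hc'.1])
  have h2 : HH2 T D c' < 0 := by
    unfold HH2
    have : 0 < D^2 - 2 - Real.cosh (c' - T) * D := by nlinarith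
    have := mul_neg_of_neg_of_pos hs this
    have := hc'.1
    exact mul_neg_of_pos_of_neg this (div_neg_of_neg_of_pos (by assumption) (by positivity))
  have h1 : HH1 T D c < 0 := by nlinarith [hc.1]
  nlinarith

lemma HH2_neg_right {T D t : ℝ} (hD : 0 < D) (hT : 0 < T) (ht : T < t)
    (h : D^2 - 2 - Real.cosh (t - T) * D < 0) : HH2 T D t < 0 := by
  have hp := cD_pos hD (t - T)
  have hs : 0 < Real.sinh (t - T) := Real.sinh_pos_iff.mpr (by linarith)
  unfold HH2
  exact mul_neg_of_pos_of_neg (by linarith) (div_neg_of_neg_of_pos (mul_neg_of_pos_of_neg hs h) (by positivity))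

lemma HH_end_nonpos {T D : ℝ} (hD : 0 < D) (hT : 0 < T) (h1 : 0 ≤ HH1 T D (2 * T)) :
    ∃ t ∈ Set.Ioo 0 (2 * T), HH T D t ≤ 0 := by
  rcases le_or_gt 0 (D^2 - 2 - Real.cosh T * D) with h | h
  · exact ⟨T, ⟨hT, by linarith⟩, (HH_neg_mid hD hT h).le⟩
  · have hc : ContinuousAt (fun t => D^2 - 2 - Real.cosh (t - T) * D) (2 * T) := by fun_prop
    have h' : (fun t => D^2 - 2 - Real.cosh (t - T) * D) (2 * T) < 0 := by
      have : 2 * T - T = T := by ring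
      simpa [this] using h
    obtain ⟨ε, hε, hb⟩ := Metric.eventually_nhds_iff.mp (hc.eventually (gt_mem_nhds h'))
    set m := min ε T with hm
    have m0 : 0 < m := lt_min hε hT
    have m1 : m ≤ ε := min_le_left _ _
    have m2 : m ≤ T := min_le_right _ _
    refine ⟨2 * T - m / 2, ⟨by linarith, by linarith⟩, ?_⟩
    obtain ⟨c, hc, e⟩ := HH_mvt (T := T) hD (show 2 * T - m / 2 < 2 * T by linarith)
    obtain ⟨c', hc', e'⟩ := HH1_mvt (T := T) hD hc.2
    rw [HH_end] at e
    have h2 : HH2 T D c' < 0 := HH2_neg_right hD hT (by linarith [hc.1, hc'.1]) (hb (by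
      rw [Real.dist_eq, abs_sub_lt_iff]; constructor <;> linarith [hc.1, hc'.1, hc'.2]))
    have : 0 ≤ HH1 T D c := by nlinarith [hc.2]
    nlinarith

lemma HH_unimodal {T D t : ℝ} (hD : 0 < D) (hD2 : D ≤ 2) (hT : 0 < T) (ht : t ∈ Set.Ioo 0 (2 * T)) :
    0 < HH T D t := by
  have key : ∀ u, D^2 - 2 - Real.cosh u * D ≤ 0 := fun u => by nlinarith [Real.one_le_cosh u]
  rcases le_or_gt t T with h | h
  · exact HH_pos_left hD ht.1 h (key _)
  · by_contra hcon
    push Not at hcon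
    have hTp : 0 < HH T D T := HH_pos_left hD hT le_rfl (key _)
    obtain ⟨a, ha, ea⟩ := HH_mvt (T := T) hD h
    obtain ⟨b, hb, eb⟩ := HH_mvt (T := T) hD ht.2
    rw [HH_end] at eb
    obtain ⟨c, hc, ec⟩ := HH1_mvt (T := T) hD (ha.2.trans hb.1)
    have hTc : T < c := ha.1.trans hc.1
    have h2 : HH2 T D c < 0 := HH2_neg_right hD hT hTc (by
      have : 1 < Real.cosh (c - T) := Real.one_lt_cosh.mpr (by linarith)
      nlinarith)
    have a1 : HH1 T D a < 0 := by nlinarith [ha.1, ha.2]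
    have b1 : 0 ≤ HH1 T D b := by
      by_contra hh
      push Not at hh
      nlinarith [ht.2]
    nlinarith [ha.2, hb.1]

open Filter Topology in
lemma HH_lim {T D t : ℕ → ℝ} {T0 D0 τ : ℝ} (hT : Tendsto T atTop (𝓝 T0)) (hD : Tendsto D atTop (𝓝 D0))
    (ht : Tendsto t atTop (𝓝 τ)) (hT0 : 0 < T0) (hD0 : 0 < D0) (hDn : ∀ n, 0 < D n)
    (hti : ∀ n, t n ∈ Set.Ioo 0 (2 * T n)) (hH : ∀ n, HH (T n) (D n) (t n) ≤ 0) :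
    ∃ t ∈ Set.Ioo 0 (2 * T0), HH T0 D0 t ≤ 0 := by
  have b0 : 0 ≤ τ := ge_of_tendsto' ht fun n => (hti n).1.le
  have b1 : τ ≤ 2 * T0 := le_of_tendsto_of_tendsto' ht (hT.const_mul 2) fun n => (hti n).2.le
  have hch : ∀ u : ℕ → ℝ, ∀ v : ℝ, Tendsto u atTop (𝓝 v) → Tendsto (fun n => Real.cosh (u n)) atTop (𝓝 (Real.cosh v)) :=
    fun u v h => (Real.continuous_cosh.tendsto v).comp h
  have hsh : ∀ u : ℕ → ℝ, ∀ v : ℝ, Tendsto u atTop (𝓝 v) → Tendsto (fun n => Real.sinh (u n)) atTop (𝓝 (Real.sinh v)) :=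
    fun u v h => (Real.continuous_sinh.tendsto v).comp h
  rcases b0.eq_or_lt with hτ | hτ
  · refine ⟨T0, ⟨hT0, by linarith⟩, (HH_neg_mid hD0 hT0 ?_).le⟩
    have hev : ∀ᶠ n in atTop, t n < T n := ht.eventually_lt hT (by linarith)
    have hl : Tendsto (fun n => (D n)^2 - 2 - Real.cosh (t n - T n) * D n) atTop
        (𝓝 (D0^2 - 2 - Real.cosh (τ - T0) * D0)) :=
      ((hD.pow 2).sub_const 2).sub ((hch _ _ (ht.sub hT)).mul hD)
    have : 0 ≤ D0^2 - 2 - Real.cosh (τ - T0) * D0 := by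
      refine ge_of_tendsto hl (hev.mono fun n hn => ?_)
      by_contra hcon
      push Not at hcon
      exact absurd (HH_pos_left (hDn n) (hti n).1 hn.le hcon.le) (not_lt.mpr (hH n))
    rwa [← hτ, zero_sub, Real.cosh_neg] at this
  rcases b1.eq_or_lt with hτ2 | hτ2
  · apply HH_end_nonpos hD0 hT0
    have : ∀ n, ∃ c ∈ Set.Ioo (t n) (2 * T n), 0 ≤ HH1 (T n) (D n) c := fun n => by
      obtain ⟨c, hc, e⟩ := HH_mvt (T := T n) (hDn n) (hti n).2
      rw [HH_end] at e
      refine ⟨c, hc, ?_⟩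
      by_contra hh
      push Not at hh
      nlinarith [(hti n).2, hH n]
    choose c hc hc1 using this
    have hcl : Tendsto c atTop (𝓝 (2 * T0)) := by
      rw [← hτ2]
      refine tendsto_of_tendsto_of_tendsto_of_le_of_le ht (by rw [hτ2]; exact hT.const_mul 2)
        (fun n => (hc n).1.le) (fun n => (hc n).2.le)
    refine ge_of_tendsto' (f := fun n => HH1 (T n) (D n) (c n)) (x := atTop) ?_ hc1
    have e1 := ((hch _ _ (hcl.sub hT)).add hD)
    have p1 := cD_pos hD0 (2 * T0 - T0)
    have p2 := cD_pos hD0 T0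
    exact ((hcl.mul ((((hch _ _ (hcl.sub hT)).mul hD).const_add 1).div (e1.pow 2) (by positivity))).sub
      ((hsh _ _ (hcl.sub hT)).div e1 p1.ne')).sub ((hsh _ _ hT).div ((hch _ _ hT).add hD) p2.ne')
  · refine ⟨τ, ⟨hτ, hτ2⟩, le_of_tendsto' (f := fun n => HH (T n) (D n) (t n)) (x := atTop) ?_ hH⟩
    have e1 := ((hch _ _ (ht.sub hT)).add hD)
    have e2 := (hch _ _ hT).add hD
    have p1 := cD_pos hD0 (τ - T0)
    have p2 := cD_pos hD0 T0
    exact (ht.mul (((hsh _ _ (ht.sub hT)).div e1 p1.ne').sub ((hsh _ _ hT).div e2 p2.ne'))).sub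
      (((e1.log p1.ne').sub (e2.log p2.ne')).const_mul 2)

open Filter Topology in
lemma HH_lim' {T D t : ℕ → ℝ} {T0 D0 : ℝ} (hT : Tendsto T atTop (𝓝 T0)) (hD : Tendsto D atTop (𝓝 D0))
    (hT0 : 0 < T0) (hD0 : 0 < D0) (hDn : ∀ n, 0 < D n)
    (hti : ∀ n, t n ∈ Set.Ioo 0 (2 * T n)) (hH : ∀ n, HH (T n) (D n) (t n) ≤ 0) :
    ∃ t ∈ Set.Ioo 0 (2 * T0), HH T0 D0 t ≤ 0 := by
  obtain ⟨M, hM⟩ := hT.bddAbove_range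
  obtain ⟨τ, -, φ, hφ, hl⟩ := (isCompact_Icc (a := (0:ℝ)) (b := 2 * M)).tendsto_subseq (x := t)
    (fun n => ⟨(hti n).1.le, (hti n).2.le.trans (by linarith [hM ⟨n, rfl⟩])⟩)
  exact HH_lim (hT.comp hφ.tendsto_atTop) (hD.comp hφ.tendsto_atTop) hl hT0 hD0 (fun n => hDn _)
    (fun n => hti _) (fun n => hH _)
noncomputable def DD (p q : ℝ) : ℝ :=
  (p * (1 - q) + q * (1 - p)) / (2 * (p * q) * Real.exp (tStar p q / 2))

lemma exp_tStar {p q : ℝ} (hp : 0 < p) (hp1 : p < 1) (hq : 0 < q) (hq1 : q < 1) :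
    Real.exp (tStar p q) * (p * q) = (1 - p) * (1 - q) := by
  have h1 : 0 < 1 - p := by linarith
  have h2 : 0 < 1 - q := by linarith
  rw [tStar, Real.exp_log (by positivity)]
  field_simp

lemma HH_eq_FF {p q t : ℝ} (hp : 0 < p) (hp1 : p < 1) (hq : 0 < q) (hq1 : q < 1) (ht : 0 < t) :
    HH (tStar p q / 2) (DD p q) t = FF t p + FF t q := by
  have h1 : 0 < 1 - p := by linarith
  have h2 : 0 < 1 - q := by linarith
  have hE := exp_tStar hp hp1 hq hq1
  have hE2 : Real.exp (tStar p q) = Real.exp (tStar p q / 2) * Real.exp (tStar p q / 2) := by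
    rw [← Real.exp_add]; ring_nf
  rw [hE2] at hE
  unfold HH DD FF
  rw [Real.sinh_eq, Real.cosh_eq, Real.sinh_eq, Real.cosh_eq, neg_sub, Real.exp_sub, Real.exp_sub, Real.exp_neg]
  have wp := FF_w_pos ht hp.le
  have wq := FF_w_pos ht hq.le
  have hX := Real.exp_pos t
  have hR := Real.exp_pos (tStar p q / 2)
  have hXl : Real.log (Real.exp t) = t := Real.log_exp t
  generalize Real.exp (tStar p q / 2) = E at *
  generalize Real.exp t = X at *
  have c1 : (X / E + E / X) / 2 + (p * (1 - q) + q * (1 - p)) / (2 * (p * q) * E) =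
     (1 + p * (X - 1)) * (1 + q * (X - 1)) / (2 * (p * q) * E * X) := by
    field_simp
    linear_combination hE
  have c2 : (E + E⁻¹) / 2 + (p * (1 - q) + q * (1 - p)) / (2 * (p * q) * E) = 1 / (2 * (p * q) * E) := by
    field_simp
    linear_combination hE
  have s1 : (X / E - E / X) / 2 = (p * q * X^2 - (1 - p) * (1 - q)) / (2 * (p * q) * E * X) := by
    field_simp
    linear_combination -hE
  have s2 : (E - E⁻¹) / 2 = (1 - p - q) / (2 * (p * q) * E) := by
    field_simp
    linear_combination hE
  rw [c1, c2, s1, s2, Real.log_div (by positivity) (by positivity), Real.log_mul wp.ne' wq.ne',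
    Real.log_div one_ne_zero (by positivity), Real.log_mul (x := 2 * (p * q) * E) (by positivity) hX.ne', hXl, Real.log_one]
  generalize Real.log (2 * (p * q) * E) = l
  generalize Real.log (1 + p * (X - 1)) = l1
  generalize Real.log (1 + q * (X - 1)) = l2
  have r1 : (p * q * X^2 - (1 - p) * (1 - q)) / (2 * (p * q) * E * X) / ((1 + p * (X - 1)) * (1 + q * (X - 1)) / (2 * (p * q) * E * X)) = p * X / (1 + p * (X - 1)) + q * X / (1 + q * (X - 1)) - 1 := by
    field_simp
    ring
  have r2 : (1 - p - q) / (2 * (p * q) * E) / (1 / (2 * (p * q) * E)) = 1 - p - q := by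
    field_simp
  rw [r1, r2]
  ring

lemma gPB_deriv {p q t : ℝ} (hp : 0 < p) (hq : 0 < q) (ht : 0 < t) :
    deriv (gPB p q) t = (FF t p + FF t q) / t^3 := by
  have wp := FF_w_pos ht hp.le
  have wq := FF_w_pos ht hq.le
  have hw : ∀ p : ℝ, 0 < p → HasDerivAt (fun t : ℝ => 1 + p * (Real.exp t - 1)) (p * Real.exp t) t := fun p _ => by
    simpa using (((Real.hasDerivAt_exp t).sub_const 1).const_mul p).const_add 1
  have hl : HasDerivAt (fun t : ℝ => -(t * (p + q))) (-(p + q)) t := by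
    have h := ((hasDerivAt_id t).mul_const (p + q)).neg
    rw [one_mul] at h
    exact h
  have hd := ((hl.add ((hw p hp).log wp.ne')).add ((hw q hq).log wq.ne')).div (hasDerivAt_pow 2 t) (pow_ne_zero 2 ht.ne')
  have heq : gPB p q =ᶠ[nhds t] fun t => (-(t * (p + q)) + Real.log (1 + p * (Real.exp t - 1)) + Real.log (1 + q * (Real.exp t - 1))) / t^2 := by
    filter_upwards [lt_mem_nhds ht] with s hs
    have w1 := FF_w_pos hs hp.le
    have w2 := FF_w_pos hs hq.le
    have e := Real.exp_pos (-(s * (p + q)))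
    rw [gPB, if_neg hs.ne', GPB, Real.log_mul (by positivity) w2.ne', Real.log_mul e.ne' w1.ne', Real.log_exp]
  have := (hd.congr_of_eventuallyEq heq).deriv
  rw [this]
  simp only [FF, Pi.add_apply]
  field_simp
  push_cast
  ring

lemma DD_pos {p q : ℝ} (hp : 0 < p) (hp1 : p < 1) (hq : 0 < q) (hq1 : q < 1) : 0 < DD p q := by
  have h1 : 0 < 1 - p := by linarith
  have h2 : 0 < 1 - q := by linarith
  unfold DD
  positivity

lemma tStar_pos {p q : ℝ} (hp : 0 < p) (hq : 0 < q) (hpq : q < 1 - p) : 0 < tStar p q := by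
  apply Real.log_pos
  rw [one_lt_div (by positivity)]
  nlinarith

lemma DD_le_two {p q : ℝ} (hp : 0 < p) (hp1 : p < 1) (hq : 0 < q) (hq1 : q < 1)
    (h : (p * (1 - q) + q * (1 - p))^2 < 16 * (p * q) * ((1 - p) * (1 - q))) : DD p q ≤ 2 := by
  have hE := exp_tStar hp hp1 hq hq1
  have hE2 : Real.exp (tStar p q) = Real.exp (tStar p q / 2) * Real.exp (tStar p q / 2) := by
    rw [← Real.exp_add]; ring_nf
  rw [hE2] at hE
  have hR := Real.exp_pos (tStar p q / 2)
  unfold DD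
  rw [div_le_iff₀ (by positivity)]
  refine (sq_le_sq₀ (by nlinarith) (by positivity)).mp ?_
  rw [← hE] at h
  nlinarith
 
lemma lt_tStar_iff {p q t : ℝ} (hp : 0 < p) (hp1 : p < 1) (hq : 0 < q) (hq1 : q < 1) :
    t < tStar p q ↔ Real.exp t * (p * q) < (1 - p) * (1 - q) := by
  rw [← exp_tStar hp hp1 hq hq1, mul_lt_mul_iff_left₀ (by positivity), Real.exp_lt_exp]

lemma exists_good (p : ℝ) (hp0 : 0 < p) (hp1 : p < (3 + Real.sqrt 3) / 6) (h1 : p < 1) :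
    ∃ q ∈ Set.Ioo (0:ℝ) (min p (1 - p)), (p * (1 - q) + q * (1 - p))^2 < 16 * (p * q) * ((1 - p) * (1 - q)) := by
  have hm : 0 < min p (1 - p) := lt_min hp0 (by linarith)
  have hc : ContinuousAt (fun q => (p * (1 - q) + q * (1 - p))^2 - 16 * (p * q) * ((1 - p) * (1 - q))) (min p (1 - p)) := by
    fun_prop
  have hlt : (fun q => (p * (1 - q) + q * (1 - p))^2 - 16 * (p * q) * ((1 - p) * (1 - q))) (min p (1 - p)) < 0 := by
    have hpp : 0 < p * (1 - p) := mul_pos hp0 (by linarith)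
    rcases le_or_gt p (1 - p) with h | h
    · simp only [min_eq_left h]
      nlinarith [mul_pos hpp hpp]
    · simp only [min_eq_right h.le]
      have hs : Real.sqrt 3 ^ 2 = 3 := Real.sq_sqrt (by norm_num)
      have hs0 : 0 ≤ Real.sqrt 3 := Real.sqrt_nonneg 3
      have k : 1 < 6 * (p * (1 - p)) := by nlinarith
      have : (p * (1 - (1 - p)) + (1 - p) * (1 - p)) = 1 - 2 * (p * (1 - p)) := by ring
      rw [this]
      have h4 : 4 * (p * (1 - p)) ≤ 1 := by nlinarith [sq_nonneg (2 * p - 1)]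
      have : 16 * (p * (1 - p)) * ((1 - p) * (1 - (1 - p))) = 16 * (p * (1 - p))^2 := by ring
      rw [this]
      nlinarith
  have hev := (hc.eventually (gt_mem_nhds hlt)).filter_mono (nhdsWithin_le_nhds (s := Set.Iio (min p (1 - p))))
  obtain ⟨q, h1, h2⟩ := (hev.and (Ioo_mem_nhdsLT hm)).exists
  exact ⟨q, h2, by simpa using h1⟩

theorem gPB_deriv_pos_middle_iff (p : ℝ) (hp0 : 0 < p) (hp1 : p < (3 + Real.sqrt 3) / 6) :
    ∃ γ ∈ Set.Ico (0:ℝ) (min p (1 - p)),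
      ∀ q ∈ Set.Ioo (0:ℝ) (min p (1 - p)),
        ((∀ t ∈ Set.Ioo 0 (tStar p q), 0 < deriv (gPB p q) t) ↔ γ < q) := by
  have hp : p < 1 := by
    have : Real.sqrt 3 < 3 := by rw [Real.sqrt_lt' (by norm_num)]; norm_num
    linarith
  have hb : ∀ q ∈ Set.Ioo (0:ℝ) (min p (1 - p)), 0 < q ∧ q < p ∧ q < 1 - p ∧ q < 1 := fun q hq =>
    ⟨hq.1, hq.2.trans_le (min_le_left _ _), hq.2.trans_le (min_le_right _ _), by linarith [hq.2.trans_le (min_le_left _ _)]⟩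
  have hpos : ∀ q : ℝ, 0 < q → ∀ t : ℝ, 0 < t → (0 < deriv (gPB p q) t ↔ 0 < FF t p + FF t q) := fun q hq t ht => by
    rw [gPB_deriv hp0 hq ht, div_pos_iff_of_pos_right (by positivity)]
  have hiff : ∀ q ∈ Set.Ioo (0:ℝ) (min p (1 - p)), ((∀ t ∈ Set.Ioo 0 (tStar p q), 0 < deriv (gPB p q) t) ↔
      ∀ t ∈ Set.Ioo 0 (tStar p q), 0 < FF t p + FF t q) := fun q hq =>
    forall₂_congr fun t ht => hpos q hq.1 t ht.1
  set S : Set ℝ := {q | q ∈ Set.Ioo (0:ℝ) (min p (1 - p)) ∧ ∀ t ∈ Set.Ioo 0 (tStar p q), 0 < FF t p + FF t q} with hS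
  have hbdd : BddBelow S := ⟨0, fun q hq => hq.1.1.le⟩
  obtain ⟨q0, hq0, hg⟩ := exists_good p hp0 hp1 hp
  have hq0S : q0 ∈ S := by
    obtain ⟨a1, a2, a3, a4⟩ := hb q0 hq0
    refine ⟨hq0, fun t ht => ?_⟩
    rw [← HH_eq_FF hp0 hp a1 a4 ht.1]
    have hT := tStar_pos hp0 a1 a3
    exact HH_unimodal (DD_pos hp0 hp a1 a4) (DD_le_two hp0 hp a1 a4 hg) (by linarith) ⟨ht.1, by linarith [ht.2]⟩
  have hγ0 : 0 ≤ sInf S := Real.sInf_nonneg fun q hq => hq.1.1.le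
  refine ⟨sInf S, ⟨hγ0, (csInf_le hbdd hq0S).trans_lt hq0.2⟩, fun q hq => ?_⟩
  rw [hiff q hq]
  obtain ⟨a1, a2, a3, a4⟩ := hb q hq
  constructor
  · intro hok
    refine lt_of_le_of_ne (csInf_le hbdd ⟨hq, hok⟩) fun heq => ?_
    set s : ℕ → ℝ := fun n => q - q / (n + 2) with hs
    have hsn : ∀ n, 0 < s n ∧ s n < q := fun n => by
      have : q / ((n:ℝ) + 2) < q := div_lt_self a1 (by have : (0:ℝ) ≤ n := Nat.cast_nonneg n
                                                       linarith)
      have : 0 < q / ((n:ℝ) + 2) := by positivity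
      constructor <;> simp only [hs] <;> linarith
    have hex : ∀ n, ∃ t ∈ Set.Ioo 0 (tStar p (s n)), FF t p + FF t (s n) ≤ 0 := fun n => by
      by_contra hcon
      push Not at hcon
      have := csInf_le hbdd (show s n ∈ S from ⟨⟨(hsn n).1, (hsn n).2.trans hq.2⟩, hcon⟩)
      linarith [(hsn n).2]
    choose t ht hH using hex
    have hsl : Filter.Tendsto s Filter.atTop (nhds q) := by
      have h1 : Filter.Tendsto (fun n : ℕ => q / ((n:ℝ) + 2)) Filter.atTop (nhds 0) :=
        Filter.Tendsto.div_atTop tendsto_const_nhds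
          (Filter.tendsto_atTop_add_const_right _ _ tendsto_natCast_atTop_atTop)
      simpa using h1.const_sub q
    have n1 : p * q ≠ 0 := by positivity
    have h1p : 0 < 1 - p := by linarith
    have h1q : 0 < 1 - q := by linarith
    have n2 : (1 - p) * (1 - q) / (p * q) ≠ 0 := by positivity
    have hTc : ContinuousAt (fun q => tStar p q / 2) q := by
      unfold tStar
      have : ContinuousAt (fun q => (1 - p) * (1 - q) / (p * q)) q := by
        apply ContinuousAt.div _ _ n1 <;> fun_prop
      exact (this.log n2).div_const 2
    have hDc : ContinuousAt (fun q => DD p q) q := by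
      unfold DD
      apply ContinuousAt.div
      · fun_prop
      · exact ContinuousAt.mul (by fun_prop) hTc.rexp
      · positivity
    obtain ⟨τ, hτ, hle⟩ := HH_lim' (t := t) (hTc.tendsto.comp hsl) (hDc.tendsto.comp hsl)
      (by linarith [tStar_pos hp0 a1 a3]) (DD_pos hp0 hp a1 a4)
      (fun n => DD_pos hp0 hp (hsn n).1 ((hsn n).2.trans a4))
      (fun n => ⟨(ht n).1, by simpa [mul_div_cancel₀] using (by linarith [(ht n).2] : t n < 2 * (tStar p (s n) / 2))⟩)
      (fun n => by
        have := HH_eq_FF hp0 hp (hsn n).1 ((hsn n).2.trans a4) (ht n).1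
        simp only [Function.comp]
        rw [this]; exact hH n)
    rw [HH_eq_FF hp0 hp a1 a4 hτ.1] at hle
    exact absurd (hok τ ⟨hτ.1, by linarith [hτ.2]⟩) (not_lt.mpr hle)
  · intro hlt t ht
    obtain ⟨s, hsS, hsq⟩ := exists_lt_of_csInf_lt ⟨q0, hq0S⟩ hlt
    obtain ⟨b1, b2, b3, b4⟩ := hb s hsS.1
    have htq := (lt_tStar_iff hp0 hp a1 a4).mp ht.2
    refine FF_up ht.1 hp0 hp b1 hsq a2 htq (hsS.2 t ⟨ht.1, (lt_tStar_iff hp0 hp b1 b4).mpr ?_⟩)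
    have := mul_pos (Real.exp_pos t) hp0
    nlinarith
end

section
/- Let p, q ∈ (0,1) with p + q < 1 and 𝒟(p,q) = 12pq(pq + p + q) − 14pq + p² + q² ≤ 0. Then g_{p,q} is strictly monotonically increasing on (−∞, t*_{p,q}] and strictly monotonically decreasing on [t*_{p,q}, ∞); in particular g_{p,q} is strictly unimodal with unique maximum at t = t*_{p,q}. -/
theorem aux_unimodal (L L1 L2 L3 : ℝ → ℝ) (m T : ℝ) (hm : 0 < m) (hmT : m < T)
    (d1 : ∀ t, HasDerivAt L (L1 t) t) (d2 : ∀ t, HasDerivAt L1 (L2 t) t)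
    (d3 : ∀ t, HasDerivAt L2 (L3 t) t) (h0 : L 0 = 0) (h10 : L1 0 = 0)
    (hpos : ∀ t, t < m → 0 < L3 t) (hneg : ∀ t, m < t → L3 t < 0)
    (hT : T * L1 T - 2 * L T = 0) (g : ℝ → ℝ) (hg0 : g 0 = L2 0 / 2)
    (hg : ∀ t, t ≠ 0 → g t = L t / t ^ 2) :
    StrictMonoOn g (Set.Iic T) ∧ StrictAntiOn g (Set.Ici T) := by
  have mono : ∀ (f f' : ℝ → ℝ) (s : Set ℝ), Convex ℝ s → (∀ t ∈ s, HasDerivAt f (f' t) t) →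
      (∀ t ∈ interior s, 0 < f' t) → StrictMonoOn f s := by
    intro f f' s hs hd hp
    apply strictMonoOn_of_deriv_pos hs (fun t ht => (hd t ht).continuousAt.continuousWithinAt)
    intro t ht
    rw [(hd t (interior_subset ht)).deriv]; exact hp t ht
  have anti : ∀ (f f' : ℝ → ℝ) (s : Set ℝ), Convex ℝ s → (∀ t ∈ s, HasDerivAt f (f' t) t) →
      (∀ t ∈ interior s, f' t < 0) → StrictAntiOn f s := by
    intro f f' s hs hd hp
    apply strictAntiOn_of_deriv_neg hs (fun t ht => (hd t ht).continuousAt.continuousWithinAt)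
    intro t ht
    rw [(hd t (interior_subset ht)).deriv]; exact hp t ht
  have dh : ∀ t, HasDerivAt (fun t => t * L1 t - 2 * L t) (t * L2 t - L1 t) t := by
    intro t
    refine HasDerivAt.congr_deriv (((hasDerivAt_id t).mul (d2 t)).sub ((d1 t).const_mul 2)) ?_
    simp; ring
  have dh' : ∀ t, HasDerivAt (fun t => t * L2 t - L1 t) (t * L3 t) t := by
    intro t
    refine HasDerivAt.congr_deriv (((hasDerivAt_id t).mul (d3 t)).sub (d2 t)) ?_
    simp
  set h : ℝ → ℝ := fun t => t * L1 t - 2 * L t with hh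
  set h' : ℝ → ℝ := fun t => t * L2 t - L1 t with hh'
  have hh0 : h 0 = 0 := by simp [hh, h0]
  have hh'0 : h' 0 = 0 := by simp [hh', h10]
  have hT' : h T = 0 := hT
  -- negative side
  have a1 : StrictAntiOn h' (Set.Iic 0) := by
    refine anti h' (fun t => t * L3 t) _ (convex_Iic 0) (fun t _ => dh' t) ?_
    intro t ht; rw [interior_Iic] at ht
    exact mul_neg_of_neg_of_pos ht (hpos t (lt_trans ht hm))
  have a2 : StrictMonoOn h (Set.Iic 0) := by
    refine mono h h' _ (convex_Iic 0) (fun t _ => dh t) ?_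
    intro t ht; rw [interior_Iic] at ht
    have := a1 (Set.mem_Iic.2 (le_of_lt ht)) (Set.mem_Iic.2 le_rfl) ht
    rwa [hh'0] at this
  have hn : ∀ t, t < 0 → h t < 0 := by
    intro t ht
    have := a2 (Set.mem_Iic.2 (le_of_lt ht)) (Set.mem_Iic.2 le_rfl) ht
    rwa [hh0] at this
  have b1 : StrictMonoOn h' (Set.Icc 0 m) := by
    refine mono h' (fun t => t * L3 t) _ (convex_Icc 0 m) (fun t _ => dh' t) ?_
    intro t ht; rw [interior_Icc] at ht
    exact mul_pos ht.1 (hpos t ht.2)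
  have b2 : StrictMonoOn h (Set.Icc 0 m) := by
    refine mono h h' _ (convex_Icc 0 m) (fun t _ => dh t) ?_
    intro t ht; rw [interior_Icc] at ht
    have := b1 (Set.left_mem_Icc.2 hm.le) ⟨ht.1.le, ht.2.le⟩ ht.1
    rwa [hh'0] at this
  have hp1 : ∀ t, 0 < t → t ≤ m → 0 < h t := by
    intro t ht htm
    have := b2 (Set.left_mem_Icc.2 hm.le) ⟨ht.le, htm⟩ ht
    rwa [hh0] at this
  have c1 : StrictAntiOn h' (Set.Ici m) := by
    refine anti h' (fun t => t * L3 t) _ (convex_Ici m) (fun t _ => dh' t) ?_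
    intro t ht; rw [interior_Ici] at ht
    exact mul_neg_of_pos_of_neg (lt_trans hm ht) (hneg t ht)
  have conc : StrictConcaveOn ℝ (Set.Ici m) h := by
    apply StrictAntiOn.strictConcaveOn_of_deriv (convex_Ici m)
      (fun t ht => (dh t).continuousAt.continuousWithinAt)
    have : deriv h = h' := funext fun t => (dh t).deriv
    rw [this]
    exact c1.mono interior_subset
  have hmp : 0 < h m := hp1 m hm le_rfl
  have hp2 : ∀ t, m < t → t < T → 0 < h t := by
    intro t h1 h2
    have := conc.slope_anti_adjacent (Set.mem_Ici.2 le_rfl) (Set.mem_Ici.2 hmT.le) h1 h2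
    rw [hT', div_lt_div_iff₀ (by linarith) (by linarith)] at this
    by_contra hc
    push Not at hc
    nlinarith [mul_pos hmp (sub_pos.2 h2), mul_nonneg (neg_nonneg.2 hc) (sub_pos.2 h1).le, mul_nonneg (neg_nonneg.2 hc) (sub_pos.2 h2).le]
  have hp3 : ∀ t, T < t → h t < 0 := by
    intro t h1
    have := conc.slope_anti_adjacent (Set.mem_Ici.2 le_rfl) (Set.mem_Ici.2 (hmT.trans h1).le) hmT h1
    rw [hT', div_lt_div_iff₀ (by linarith) (by linarith)] at this
    by_contra hc
    push Not at hc
    nlinarith [mul_pos hmp (sub_pos.2 h1), mul_nonneg hc (sub_pos.2 hmT).le]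
  have hp : ∀ t, 0 < t → t < T → 0 < h t := by
    intro t h1 h2
    rcases le_or_gt t m with h3 | h3
    · exact hp1 t h1 h3
    · exact hp2 t h3 h2
  have dg : ∀ t, t ≠ 0 → HasDerivAt g (h t / t ^ 3) t := by
    intro t ht
    have e : g =ᶠ[nhds t] fun t => L t / t ^ 2 := by
      filter_upwards [isOpen_ne.mem_nhds ht] with x hx using hg x hx
    refine HasDerivAt.congr_of_eventuallyEq ?_ e
    refine HasDerivAt.congr_deriv ((d1 t).div (hasDerivAt_pow 2 t) (pow_ne_zero 2 ht)) ?_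
    simp only [hh]
    field_simp
    try ring
  have g1 : StrictMonoOn g (Set.Iio 0) := by
    refine mono g _ _ (convex_Iio 0) (fun t ht => dg t (ne_of_lt ht)) ?_
    intro t ht; rw [interior_Iio] at ht
    exact div_pos_of_neg_of_neg (hn t ht) (Odd.pow_neg (by decide) ht)
  have g2 : StrictMonoOn g (Set.Ioc 0 T) := by
    refine mono g _ _ (convex_Ioc 0 T) (fun t ht => dg t (ne_of_gt ht.1)) ?_
    intro t ht; rw [interior_Ioc] at ht
    exact div_pos (hp t ht.1 ht.2) (pow_pos ht.1 3)
  have g3 : StrictAntiOn g (Set.Ici T) := by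
    have hT0 : 0 < T := hm.trans hmT
    refine anti g _ _ (convex_Ici T) (fun t ht => dg t (ne_of_gt (lt_of_lt_of_le hT0 ht))) ?_
    intro t ht; rw [interior_Ici] at ht
    exact div_neg_of_neg_of_pos (hp3 t ht) (pow_pos (hT0.trans ht) 3)
  -- comparison with zero
  have k2 : StrictMonoOn L2 (Set.Iic m) := by
    refine mono L2 L3 _ (convex_Iic m) (fun t _ => d3 t) ?_
    intro t ht; rw [interior_Iic] at ht; exact hpos t ht
  set c := L2 0 with hc
  have dk1 : ∀ t, HasDerivAt (fun t => L1 t - c * t) (L2 t - c) t := by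
    intro t
    refine HasDerivAt.congr_deriv ((d2 t).sub ((hasDerivAt_id t).const_mul c)) ?_
    simp
  have dk : ∀ t, HasDerivAt (fun t => L t - c * t ^ 2 / 2) (L1 t - c * t) t := by
    intro t
    refine HasDerivAt.congr_deriv ((d1 t).sub (((hasDerivAt_pow 2 t).const_mul c).div_const 2)) ?_
    simp; ring
  have e1 : StrictAntiOn (fun t => L1 t - c * t) (Set.Iic 0) := by
    refine anti _ _ _ (convex_Iic 0) (fun t _ => dk1 t) ?_
    intro t ht; rw [interior_Iic] at ht
    exact sub_neg.2 (k2 (Set.mem_Iic.2 (lt_trans ht hm).le) (Set.mem_Iic.2 hm.le) ht)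
  have e2 : StrictMonoOn (fun t => L1 t - c * t) (Set.Icc 0 m) := by
    refine mono _ _ _ (convex_Icc 0 m) (fun t _ => dk1 t) ?_
    intro t ht; rw [interior_Icc] at ht
    exact sub_pos.2 (k2 (Set.mem_Iic.2 hm.le) (Set.mem_Iic.2 ht.2.le) ht.1)
  have e3 : StrictMonoOn (fun t => L t - c * t ^ 2 / 2) (Set.Iic 0) := by
    refine mono _ _ _ (convex_Iic 0) (fun t _ => dk t) ?_
    intro t ht; rw [interior_Iic] at ht
    have := e1 (Set.mem_Iic.2 (le_of_lt ht)) (Set.mem_Iic.2 le_rfl) ht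
    simpa [h10] using this
  have e4 : StrictMonoOn (fun t => L t - c * t ^ 2 / 2) (Set.Icc 0 m) := by
    refine mono _ _ _ (convex_Icc 0 m) (fun t _ => dk t) ?_
    intro t ht; rw [interior_Icc] at ht
    have := e2 (Set.left_mem_Icc.2 hm.le) ⟨ht.1.le, ht.2.le⟩ ht.1
    simpa [h10] using this
  have f1 : ∀ t, t < 0 → g t < g 0 := by
    intro t ht
    have := e3 (Set.mem_Iic.2 (le_of_lt ht)) (Set.mem_Iic.2 le_rfl) ht
    simp only [h0] at this
    rw [hg t ht.ne, hg0, div_lt_div_iff₀ (sq_pos_of_neg ht) (by norm_num)]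
    linarith
  have f2 : ∀ t, 0 < t → t ≤ m → g 0 < g t := by
    intro t ht htm
    have := e4 (Set.left_mem_Icc.2 hm.le) ⟨ht.le, htm⟩ ht
    simp only [h0] at this
    rw [hg t ht.ne', hg0, div_lt_div_iff₀ (by norm_num) (by positivity)]
    linarith
  have f3 : ∀ t, 0 < t → t ≤ T → g 0 < g t := by
    intro t ht htT
    rcases le_or_gt t m with h3 | h3
    · exact f2 t ht h3
    · exact (f2 m hm le_rfl).trans (g2 ⟨hm, hmT.le⟩ ⟨ht, htT⟩ h3)
  refine ⟨?_, g3⟩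
  intro x hx y hy hxy
  rcases lt_trichotomy y 0 with hy0 | hy0 | hy0
  · exact g1 (hxy.trans hy0) hy0 hxy
  · subst hy0; exact f1 x hxy
  · rcases lt_trichotomy x 0 with hx0 | hx0 | hx0
    · exact (f1 x hx0).trans (f3 y hy0 hy)
    · subst hx0; exact f3 y hy0 hy
    · exact g2 ⟨hx0, hx⟩ ⟨hy0, hy⟩ hxy

theorem aux_factor (x y : ℝ) (hx : 0 < x) (hy : 0 < y) (hxy : x * y ≠ 1)
    (h14 : x ^ 2 + y ^ 2 ≤ 14 * (x * y)) :
    0 < (x + y) * (1 + x * y) + 6 * (x * y) - x ^ 2 - y ^ 2 := by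
  have h1 : (x + y) / 2 < 1 + x * y := by
    have : 0 < (x * y - 1) ^ 2 := by
      have := sub_ne_zero.2 hxy
      positivity
    apply lt_of_pow_lt_pow_left₀ 2 (by positivity)
    nlinarith
  nlinarith [mul_pos (add_pos hx hy) (sub_pos.2 h1)]

theorem aux_sign (x y : ℝ) (hx : 0 < x) (hy : 0 < y) :
    x * (1 - x) / (1 + x) ^ 3 + y * (1 - y) / (1 + y) ^ 3 =
    (1 - x * y) * (((x + y) * (1 + x * y) + 6 * (x * y) - x ^ 2 - y ^ 2) /
      ((1 + x) ^ 3 * (1 + y) ^ 3)) := by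
  field_simp
  ring

theorem aux_deriv1 (a : ℝ) (ha : 0 < a) (t : ℝ) :
    HasDerivAt (fun t => Real.log (1 + a * Real.exp t) - Real.log (1 + a) - a / (1 + a) * t)
      (a * Real.exp t / (1 + a * Real.exp t) - a / (1 + a)) t := by
  have hE := Real.exp_pos t
  have h1 : HasDerivAt (fun t => 1 + a * Real.exp t) (a * Real.exp t) t :=
    ((Real.hasDerivAt_exp t).const_mul a).const_add 1
  refine HasDerivAt.congr_deriv (((h1.log (by positivity)).sub_const (Real.log (1 + a))).sub
    ((hasDerivAt_id t).const_mul (a / (1 + a)))) ?_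
  simp

theorem aux_deriv2 (a : ℝ) (ha : 0 < a) (t : ℝ) :
    HasDerivAt (fun t => a * Real.exp t / (1 + a * Real.exp t) - a / (1 + a))
      (a * Real.exp t / (1 + a * Real.exp t) ^ 2) t := by
  have hE := Real.exp_pos t
  have h0 : HasDerivAt (fun t => a * Real.exp t) (a * Real.exp t) t :=
    (Real.hasDerivAt_exp t).const_mul a
  refine HasDerivAt.congr_deriv ((h0.div (h0.const_add 1) (by positivity)).sub_const (a / (1 + a))) ?_
  field_simp
  ring

theorem aux_deriv3 (a : ℝ) (ha : 0 < a) (t : ℝ) :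
    HasDerivAt (fun t => a * Real.exp t / (1 + a * Real.exp t) ^ 2)
      (a * Real.exp t * (1 - a * Real.exp t) / (1 + a * Real.exp t) ^ 3) t := by
  have hE := Real.exp_pos t
  have h0 : HasDerivAt (fun t => a * Real.exp t) (a * Real.exp t) t :=
    (Real.hasDerivAt_exp t).const_mul a
  refine HasDerivAt.congr_deriv (h0.div ((h0.const_add 1).pow 2) (pow_ne_zero 2 (by positivity))) ?_
  simp
  field_simp
  ring

/-- For `p, q ∈ (0,1)` with `p + q < 1` and `𝒟(p,q) ≤ 0`, the function `g_{p,q}`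
is strictly increasing on `(−∞, t*_{p,q}]` and strictly decreasing on
`[t*_{p,q}, ∞)`; in particular it is strictly unimodal with unique maximum at
`t = t*_{p,q}`. -/
theorem gPB_strict_unimodal_of_D_nonpos (p q : ℝ) (hp0 : 0 < p) (hp1 : p < 1)
    (hq0 : 0 < q) (hq1 : q < 1) (hpq : p + q < 1)
    (hD : 12*p*q*(p*q + p + q) - 14*p*q + p^2 + q^2 ≤ 0) :
    StrictMonoOn (gPB p q) (Set.Iic (tStar p q)) ∧
    StrictAntiOn (gPB p q) (Set.Ici (tStar p q)) := by
  have hA : 0 < 1 - p := by linarith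
  have hB : 0 < 1 - q := by linarith
  obtain ⟨a, ha⟩ : ∃ a, a = p / (1 - p) := ⟨_, rfl⟩
  obtain ⟨b, hb⟩ : ∃ b, b = q / (1 - q) := ⟨_, rfl⟩
  have ha0 : 0 < a := by rw [ha]; positivity
  have hb0 : 0 < b := by rw [hb]; positivity
  have hpa : p = a / (1 + a) := by
    rw [ha]; field_simp; ring
  have hqb : q = b / (1 + b) := by
    rw [hb]; field_simp; ring
  have h14 : a ^ 2 + b ^ 2 ≤ 14 * (a * b) := by
    have e : 14 * (a * b) - (a ^ 2 + b ^ 2) =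
      (14 * (p * q * (1 - p) * (1 - q)) - p ^ 2 * (1 - q) ^ 2 - q ^ 2 * (1 - p) ^ 2) /
        ((1 - p) ^ 2 * (1 - q) ^ 2) := by
      rw [ha, hb]; field_simp; try ring
    have : 0 ≤ 14 * (a * b) - (a ^ 2 + b ^ 2) := by
      rw [e]
      apply div_nonneg _ (by positivity)
      nlinarith [mul_pos (mul_pos hp0 hq0) (mul_pos hp0 hq0)]
    linarith
  have hexp : Real.exp (tStar p q) = 1 / (a * b) := by
    rw [tStar, Real.exp_log (by positivity), ha, hb]
    field_simp
  have hTpos : 0 < tStar p q := by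
    apply Real.log_pos
    rw [lt_div_iff₀ (by positivity)]
    nlinarith
  have hxy : ∀ t, (a * Real.exp t) * (b * Real.exp t) = Real.exp (2 * t - tStar p q) := by
    intro t
    rw [Real.exp_sub, hexp, two_mul, Real.exp_add]
    field_simp
  have h14' : ∀ t, (a * Real.exp t) ^ 2 + (b * Real.exp t) ^ 2 ≤
      14 * ((a * Real.exp t) * (b * Real.exp t)) := by
    intro t
    have := mul_le_mul_of_nonneg_right h14 (sq_nonneg (Real.exp t))
    nlinarith
  have hlog : ∀ t, Real.log (GPB p q t) =
      (Real.log (1 + a * Real.exp t) - Real.log (1 + a) - a / (1 + a) * t) +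
      (Real.log (1 + b * Real.exp t) - Real.log (1 + b) - b / (1 + b) * t) := by
    intro t
    have hE := Real.exp_pos t
    have e1 : 1 + p * (Real.exp t - 1) = (1 + a * Real.exp t) / (1 + a) := by
      rw [hpa]; field_simp; ring
    have e2 : 1 + q * (Real.exp t - 1) = (1 + b * Real.exp t) / (1 + b) := by
      rw [hqb]; field_simp; ring
    rw [GPB, e1, e2, Real.log_mul (by positivity) (by positivity),
      Real.log_mul (by positivity) (by positivity), Real.log_exp,
      Real.log_div (by positivity) (by positivity), Real.log_div (by positivity) (by positivity),
      ← hpa, ← hqb]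
    ring
  refine aux_unimodal
    (fun t => (Real.log (1 + a * Real.exp t) - Real.log (1 + a) - a / (1 + a) * t) +
      (Real.log (1 + b * Real.exp t) - Real.log (1 + b) - b / (1 + b) * t))
    (fun t => (a * Real.exp t / (1 + a * Real.exp t) - a / (1 + a)) +
      (b * Real.exp t / (1 + b * Real.exp t) - b / (1 + b)))
    (fun t => a * Real.exp t / (1 + a * Real.exp t) ^ 2 +
      b * Real.exp t / (1 + b * Real.exp t) ^ 2)
    (fun t => a * Real.exp t * (1 - a * Real.exp t) / (1 + a * Real.exp t) ^ 3 +
      b * Real.exp t * (1 - b * Real.exp t) / (1 + b * Real.exp t) ^ 3)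
    (tStar p q / 2) (tStar p q) (by linarith) (by linarith)
    (fun t => (aux_deriv1 a ha0 t).add (aux_deriv1 b hb0 t))
    (fun t => (aux_deriv2 a ha0 t).add (aux_deriv2 b hb0 t))
    (fun t => (aux_deriv3 a ha0 t).add (aux_deriv3 b hb0 t))
    (by simp) (by simp) ?_ ?_ ?_ (gPB p q) ?_ ?_
  · intro t ht
    have hE := Real.exp_pos t
    have h1 : (a * Real.exp t) * (b * Real.exp t) < 1 := by
      rw [hxy, Real.exp_lt_one_iff]; linarith
    have h2 := aux_factor _ _ (by positivity) (by positivity) h1.ne (h14' t)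
    rw [aux_sign _ _ (by positivity) (by positivity)]
    exact mul_pos (by linarith) (div_pos h2 (by positivity))
  · intro t ht
    have hE := Real.exp_pos t
    have h1 : 1 < (a * Real.exp t) * (b * Real.exp t) := by
      rw [hxy, Real.one_lt_exp_iff]; linarith
    have h2 := aux_factor _ _ (by positivity) (by positivity) h1.ne' (h14' t)
    rw [aux_sign _ _ (by positivity) (by positivity)]
    exact mul_neg_of_neg_of_pos (by linarith) (div_pos h2 (by positivity))
  · skip
    have e1 : 1 + a * Real.exp (tStar p q) = (1 + b) / b := by
      rw [hexp]; field_simp; try ring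
    have e2 : 1 + b * Real.exp (tStar p q) = (1 + a) / a := by
      rw [hexp]; field_simp; try ring
    have e3 : a * Real.exp (tStar p q) = 1 / b := by
      rw [hexp]; field_simp
    have e4 : b * Real.exp (tStar p q) = 1 / a := by
      rw [hexp]; field_simp
    have e5 : tStar p q = - (Real.log a + Real.log b) := by
      rw [← Real.log_exp (tStar p q), hexp, one_div, Real.log_inv,
        Real.log_mul ha0.ne' hb0.ne']
    rw [e1, e2, e3, e4, Real.log_div (by positivity) (by positivity),
      Real.log_div (by positivity) (by positivity), e5]
    field_simp
    ring
  · simp only [gPB, if_true, Real.exp_zero, mul_one]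
    rw [hpa, hqb]
    field_simp
    ring
  · intro t ht
    simp only [gPB, if_neg ht]
    rw [hlog]
end

section
/- (Kearns–Saul inequality for Poisson-binomial sums of two terms.) Let p, q ∈ (0,1) with p + q < 1 and 𝒟(p,q) = 12pq(pq + p + q) − 14pq + p² + q² ≤ 0. Then for every real t: exp(−t(p+q))·(1 + p(eᵗ−1))·(1 + q(eᵗ−1)) ≤ exp( ((1 − p − q)/log(((1−p)(1−q))/(p·q))) · t² ). (The left-hand side is the Laplace transform E e^{tX} of X ~ PoiBin₂(p,q), the sum of two independent mean-zero (generalised) Bernoulli random variables with parameters p and q.) -/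
lemma ks_hasDeriv_phi (k : ℝ) (hk : 0 < k) (s : ℝ) :
    HasDerivAt (fun s => Real.sinh s / (Real.cosh s + k))
      ((1 + k * Real.cosh s) / (Real.cosh s + k)^2) s := by
  have hc := Real.cosh_pos s
  have h := (Real.hasDerivAt_sinh s).div ((Real.hasDerivAt_cosh s).add_const k) (by positivity)
  have e : Real.cosh s * (Real.cosh s + k) - Real.sinh s * Real.sinh s = 1 + k * Real.cosh s := by
    linear_combination Real.cosh_sq s
  rw [e] at h
  exact h

lemma ks_alg (k x y : ℝ) (hk : 0 < k) (hk2 : k ≤ 2) (hx : 1 ≤ x) (hxy : x ≤ y) :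
    (1 + k * y) / (y + k)^2 ≤ (1 + k * x) / (x + k)^2 := by
  have hx0 : 0 < x := by linarith
  have hy0 : 0 < y := by linarith
  rw [div_le_div_iff₀ (by positivity) (by positivity)]
  have e : (1 + k * x) * (y + k)^2 - (1 + k * y) * (x + k)^2
      = (y - x) * ((x + y) + 2 * k - k^3 + k * x * y) := by ring
  have h1 : 0 ≤ (x + y) + 2 * k - k^3 + k * x * y := by
    have : 1 ≤ x * y := by nlinarith
    nlinarith [mul_nonneg hk.le (sub_nonneg.2 this), mul_nonneg (sq_nonneg (k+1)) (sub_nonneg.2 hk2)]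
  nlinarith [mul_nonneg (sub_nonneg.2 hxy) h1]

lemma ks_concave (k : ℝ) (hk : 0 < k) (hk2 : k ≤ 2) :
    ConcaveOn ℝ (Set.Ici 0) (fun s => Real.sinh s / (Real.cosh s + k)) := by
  apply AntitoneOn.concaveOn_of_deriv (convex_Ici 0)
  · exact fun s _ => (ks_hasDeriv_phi k hk s).continuousAt.continuousWithinAt
  · exact fun s _ => (ks_hasDeriv_phi k hk s).differentiableAt.differentiableWithinAt
  · intro x hx y hy hxy
    rw [interior_Ici] at hx hy
    rw [(ks_hasDeriv_phi k hk x).deriv, (ks_hasDeriv_phi k hk y).deriv]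
    apply ks_alg k _ _ hk hk2 (Real.one_le_cosh x)
    rw [Real.cosh_le_cosh, abs_of_pos hx, abs_of_pos hy]
    exact hxy

/-- chord comparison -/
lemma ks_chord (k : ℝ) (hk : 0 < k) (hk2 : k ≤ 2) (x y : ℝ) (hx : 0 ≤ x) (hxy : x ≤ y)
    (hy : 0 < y) :
    Real.sinh y / (Real.cosh y + k) * x ≤ Real.sinh x / (Real.cosh x + k) * y := by
  have h := (ks_concave k hk hk2).2 (Set.mem_Ici.2 hy.le) (Set.mem_Ici.2 (le_refl (0:ℝ)))
    (show 0 ≤ x / y by positivity)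
    (show 0 ≤ 1 - x / y by rw [sub_nonneg, div_le_one hy]; exact hxy) (by ring)
  simp only [smul_eq_mul, mul_zero, add_zero, Real.sinh_zero, zero_div] at h
  rw [div_mul_cancel₀ _ hy.ne'] at h
  have h2 := mul_le_mul_of_nonneg_right h hy.le
  calc _ = x / y * (Real.sinh y / (Real.cosh y + k)) * y := by field_simp
    _ ≤ _ := h2

lemma ks_main_nonneg (k m s : ℝ) (hk : 0 < k) (hk2 : k ≤ 2) (hm : 0 < m) (hs : 0 ≤ s) :
    Real.log (Real.cosh s + k) - Real.sinh m / (Real.cosh m + k) / (2 * m) * s^2 ≤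
    Real.log (Real.cosh m + k) - Real.sinh m / (Real.cosh m + k) / (2 * m) * m^2 := by
  set A := Real.sinh m / (Real.cosh m + k) with hA
  have hd : ∀ x : ℝ, HasDerivAt (fun s => Real.log (Real.cosh s + k) - A / (2 * m) * s^2)
      (Real.sinh x / (Real.cosh x + k) - A / m * x) x := by
    intro x
    have hc := Real.cosh_pos x
    have h := (((Real.hasDerivAt_cosh x).add_const k).log (by positivity)).sub
      ((hasDerivAt_pow 2 x).const_mul (A / (2 * m)))
    have e : A / (2 * m) * (((2 : ℕ) : ℝ) * x ^ (2 - 1)) = A / m * x := by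
      push_cast
      field_simp
      try simp
    rw [e] at h
    exact h
  have hcont : Continuous (fun s => Real.log (Real.cosh s + k) - A / (2 * m) * s^2) :=
    continuous_iff_continuousAt.2 fun x => (hd x).continuousAt
  rcases le_total s m with h | h
  · have hmono : MonotoneOn (fun s => Real.log (Real.cosh s + k) - A / (2 * m) * s^2)
        (Set.Icc 0 m) := by
      apply monotoneOn_of_deriv_nonneg (convex_Icc 0 m) hcont.continuousOn
      · exact fun x _ => (hd x).differentiableAt.differentiableWithinAt
      · intro x hx
        rw [interior_Icc] at hx
        rw [(hd x).deriv, sub_nonneg, div_mul_eq_mul_div, div_le_iff₀ hm]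
        exact ks_chord k hk hk2 x m hx.1.le hx.2.le hm
    exact hmono ⟨hs, h⟩ ⟨hm.le, le_rfl⟩ h
  · have hanti : AntitoneOn (fun s => Real.log (Real.cosh s + k) - A / (2 * m) * s^2)
        (Set.Ici m) := by
      apply antitoneOn_of_deriv_nonpos (convex_Ici m) hcont.continuousOn
      · exact fun x _ => (hd x).differentiableAt.differentiableWithinAt
      · intro x hx
        rw [interior_Ici] at hx
        have hx' : m < x := hx
        rw [(hd x).deriv, sub_nonpos, div_mul_eq_mul_div, le_div_iff₀ hm]
        exact ks_chord k hk hk2 m x hm.le hx'.le (hm.trans hx')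
    exact hanti (Set.mem_Ici.2 le_rfl) h h

lemma ks_main (k m s : ℝ) (hk : 0 < k) (hk2 : k ≤ 2) (hm : 0 < m) :
    Real.log (Real.cosh s + k) - Real.sinh m / (Real.cosh m + k) / (2 * m) * s^2 ≤
    Real.log (Real.cosh m + k) - Real.sinh m / (Real.cosh m + k) / (2 * m) * m^2 := by
  have h := ks_main_nonneg k m |s| hk hk2 hm (abs_nonneg s)
  rwa [Real.cosh_abs, sq_abs] at h


/-- **Kearns–Saul inequality for Poisson-binomial sums of two terms.**
For `p, q ∈ (0,1)` with `p + q < 1` and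
`𝒟(p,q) = 12pq(pq + p + q) − 14pq + p² + q² ≤ 0`, the Laplace transform
`E e^{tX} = exp(−t(p+q))·(1 + p(eᵗ−1))·(1 + q(eᵗ−1))` of `X ~ PoiBin₂(p,q)` satisfies
`E e^{tX} ≤ exp(((1 − p − q)/log(((1−p)(1−q))/(p·q)))·t²)` for every real `t`. -/
theorem kearns_saul_poisson_binomial (p q t : ℝ) (hp0 : 0 < p) (hp1 : p < 1)
    (hq0 : 0 < q) (hq1 : q < 1) (hpq : p + q < 1)
    (hD : 12*p*q*(p*q + p + q) - 14*p*q + p^2 + q^2 ≤ 0) :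
    Real.exp (-(t * (p + q))) * (1 + p * (Real.exp t - 1)) * (1 + q * (Real.exp t - 1)) ≤
      Real.exp ((1 - p - q) / Real.log ((1 - p) * (1 - q) / (p * q)) * t^2) := by
  have hpq0 : 0 < p * q := mul_pos hp0 hq0
  have hp1' : 0 < 1 - p := by linarith
  have hq1' : 0 < 1 - q := by linarith
  have hR1 : 1 < (1 - p) * (1 - q) / (p * q) := by
    rw [one_lt_div hpq0]; nlinarith
  have hR0 : 0 < (1 - p) * (1 - q) / (p * q) := by linarith
  obtain ⟨m, hm⟩ : ∃ m, m = Real.log ((1 - p) * (1 - q) / (p * q)) / 2 := ⟨_, rfl⟩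
  have hl : Real.log ((1 - p) * (1 - q) / (p * q)) = 2 * m := by rw [hm]; ring
  have hm0 : 0 < m := by have := Real.log_pos hR1; linarith
  obtain ⟨E, hE⟩ : ∃ E, E = Real.exp m := ⟨_, rfl⟩
  have hE0 : 0 < E := hE ▸ Real.exp_pos m
  have hE2 : p * q * E^2 = (1 - p) * (1 - q) := by
    have : E^2 = (1 - p) * (1 - q) / (p * q) := by
      rw [hE, ← Real.exp_nat_mul, ← Real.exp_log hR0, hl]; norm_num
    rw [this]; field_simp
  have hw : 0 < p + q - 2 * p * q := by nlinarith
  obtain ⟨k, hk⟩ : ∃ k, k = (p + q - 2 * p * q) / (2 * p * q * E) := ⟨_, rfl⟩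
  have hk0 : 0 < k := by rw [hk]; positivity
  have hkE : 2 * (p * q) * k * E = p + q - 2 * p * q := by
    rw [hk]; field_simp
  have hk2 : k ≤ 2 := by
    have h1 : (p + q - 2 * p * q)^2 ≤ (4 * (p * q) * E)^2 := by
      have : (4 * (p * q) * E)^2 = 16 * (p * q) * ((1 - p) * (1 - q)) := by
        rw [← hE2]; ring
      rw [this]
      nlinarith [sq_nonneg (p * q)]
    have h2 := abs_le_of_sq_le_sq h1 (by positivity)
    rw [hk, div_le_iff₀ (by positivity)]
    linarith [le_abs_self (p + q - 2 * p * q)]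
  obtain ⟨s, hs⟩ : ∃ s, s = t - m := ⟨_, rfl⟩
  have ht : t = s + m := by rw [hs]; ring
  obtain ⟨S, hS⟩ : ∃ S, S = Real.exp s := ⟨_, rfl⟩
  have hS0 : 0 < S := hS ▸ Real.exp_pos s
  have hcm := Real.cosh_pos m
  have hcs := Real.cosh_pos s
  have hcE : Real.cosh m * (2 * E) = E^2 + 1 := by
    rw [Real.cosh_eq, Real.exp_neg, ← hE]; field_simp
  have hsE : Real.sinh m * (2 * E) = E^2 - 1 := by
    rw [Real.sinh_eq, Real.exp_neg, ← hE]; field_simp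
  have hcS : Real.cosh s * (2 * S) = S^2 + 1 := by
    rw [Real.cosh_eq, Real.exp_neg, ← hS]; field_simp
  have h1 : 2 * (p * q) * E * (Real.cosh m + k) = 1 := by
    linear_combination p * q * hcE + hE2 + hkE
  have hA : Real.sinh m / (Real.cosh m + k) = 1 - p - q := by
    rw [div_eq_iff (by positivity)]
    apply mul_left_cancel₀ (show 2 * (p * q) * E ≠ 0 by positivity)
    linear_combination p * q * hsE + hE2 - (1 - p - q) * h1
  have hmain := ks_main k m s hk0 hk2 hm0
  rw [hA] at hmain
  have het : Real.exp t = S * E := by rw [ht, Real.exp_add, hS, hE]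
  have hprod : (1 + p * (Real.exp t - 1)) * (1 + q * (Real.exp t - 1))
      = Real.exp (t + (Real.log (Real.cosh s + k) - Real.log (Real.cosh m + k))) := by
    rw [Real.exp_add, Real.exp_sub, Real.exp_log (by positivity), Real.exp_log (by positivity),
      het]
    have h3 : (1 + p * (S * E - 1)) * (1 + q * (S * E - 1))
        = 2 * (p * q) * E * (S * E * (Real.cosh s + k)) := by
      linear_combination (-1 : ℝ) * hE2 - S * E * hkE - p * q * E^2 * hcS
    rw [h3, ← mul_div_assoc, eq_div_iff (by positivity)]
    linear_combination S * E * (Real.cosh s + k) * h1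
  rw [mul_assoc, hprod, ← Real.exp_add, Real.exp_le_exp, hl]
  have e : (1 - p - q) / (2 * m) * t^2 = (1 - p - q) / (2 * m) * s^2
      - (1 - p - q) / (2 * m) * m^2 + (1 - p - q) * t := by
    rw [ht]; field_simp; ring
  rw [e]
  linarith
end
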